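/- If D = (V,E) is a (possibly infinite) digraph and s, t ∈ V are distinct vertices, then there is a set P of pairwise edge-disjoint st-paths and an st-cut C such that C is a transversal of P, i.e., C contains exactly one edge from each path in P (Aharoni–Berger, edge version of the infinite Menger theorem). -/

import Mathlib

/-- A digraph on vertex type `V` with edge type `E` (parallel edges allowed, no loops). -/
structure MultiDigraph (V : Type*) (E : Type*) where
  tail : E → V
  head : E → V
  no_loops : ∀ e, tail e ≠ head e

namespace MultiDigraph

variable {V E : Type*}

/-- `p` is a (finite) directed path from `s` to `t` in the spanning subdigraph `D(L)`,
identified with its list of edges (consecutive edges are incident, visited vertices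
are pairwise distinct). -/
def IsPathIn (D : MultiDigraph V E) (L : Set E) (s t : V) (p : List E) : Prop :=
  ∃ hne : p ≠ [],
    D.tail (p.head hne) = s ∧
    D.head (p.getLast hne) = t ∧
    p.Chain' (fun e f => D.head e = D.tail f) ∧
    (s :: p.map D.head).Nodup ∧
    ∀ e ∈ p, e ∈ L

/-- `δ_{D(L)}(v)`: the set of ingoing edges of `v` lying in `L`. -/
def delta (D : MultiDigraph V E) (L : Set E) (v : V) : Set E :=
  {e | e ∈ L ∧ D.head e = v}

/-- `δ_{D(L)}(X)`: the set of edges of `D(L)` entering the vertex set `X`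
(tail outside `X`, head inside `X`). -/
def edgesInto (D : MultiDigraph V E) (L : Set E) (X : Set V) : Set E :=
  {e | e ∈ L ∧ D.tail e ∉ X ∧ D.head e ∈ X}

/-- `I ∈ 𝒢_{D(L)}(v)`: `I` is a set of ingoing edges of `v` in `D(L)` for which
there is a set of pairwise edge-disjoint `r`–`v` paths of `D(L)` covering `I`. -/
def MemGv (D : MultiDigraph V E) (L : Set E) (r v : V) (I : Set E) : Prop :=
  I ⊆ D.delta L v ∧
  ∃ Ps : Set (List E),
    (∀ p ∈ Ps, D.IsPathIn L r v p) ∧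
    Ps.Pairwise (fun p q => p.Disjoint q) ∧
    ∀ e ∈ I, ∃ p ∈ Ps, e ∈ p

/-- `L' ∈ 𝒢(D(L))`: `L'` is a union `⋃_{v ≠ r} I_v` with `I_v ∈ 𝒢_{D(L)}(v)`;
equivalently, every edge of `L'` has head distinct from `r` and for each `v ≠ r`
the set of ingoing edges of `v` in `L'` belongs to `𝒢_{D(L)}(v)`. -/
def MemG (D : MultiDigraph V E) (L : Set E) (r : V) (L' : Set E) : Prop :=
  L' ⊆ L ∧ (∀ e ∈ L', D.head e ≠ r) ∧
    ∀ v, v ≠ r → D.MemGv L r v (D.delta L' v)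

/-- `F` is a flame: `F ∈ 𝒢(D(F))`. -/
def IsFlame (D : MultiDigraph V E) (r : V) (F : Set E) : Prop :=
  D.MemG F r F

/-- `C` is a transversal of the set `Ps` of paths: `C` consists of exactly one
edge from each path in `Ps`. -/
def IsTransversal (Ps : Set (List E)) (C : Set E) : Prop :=
  (∀ p ∈ Ps, ∃! e, e ∈ C ∧ e ∈ p) ∧ ∀ e ∈ C, ∃ p ∈ Ps, e ∈ p

/-- `C` is an `s`–`t` cut in `D(L)`: every `s`–`t` path of `D(L)` meets `C`. -/
def IsCut (D : MultiDigraph V E) (L : Set E) (s t : V) (C : Set E) : Prop :=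
  ∀ p, D.IsPathIn L s t p → ∃ e ∈ p, e ∈ C

/-- `L` is large at `v`: `D(L)` admits a set `Ps` of pairwise edge-disjoint
`r`–`v` paths together with a transversal of `Ps` that is an `r`–`v` cut in `D`. -/
def LargeAt (D : MultiDigraph V E) (r v : V) (L : Set E) : Prop :=
  ∃ (Ps : Set (List E)) (C : Set E),
    (∀ p ∈ Ps, D.IsPathIn L r v p) ∧
    Ps.Pairwise (fun p q => p.Disjoint q) ∧
    IsTransversal Ps C ∧
    D.IsCut Set.univ r v C

/-- `L` is large: it is large at every `v ≠ r`. -/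
def Large (D : MultiDigraph V E) (r : V) (L : Set E) : Prop :=
  ∀ v, v ≠ r → D.LargeAt r v L

/-- `D` contains a directed cycle. -/
def HasCycle (D : MultiDigraph V E) : Prop :=
  ∃ (p : List E) (hne : p ≠ []),
    p.Chain' (fun e f => D.head e = D.tail f) ∧
    D.head (p.getLast hne) = D.tail (p.head hne) ∧
    (p.map D.head).Nodup

/-- `D` contains a backward-infinite path: edges `…, f 2, f 1, f 0` (with `f 0` the
last edge, so the path has a final vertex `D.head (f 0)` but no first vertex); the
visited vertices `D.head (f n)` are pairwise distinct. -/
def HasBackwardInfinitePath (D : MultiDigraph V E) : Prop :=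
  ∃ f : ℕ → E,
    (∀ n, D.tail (f n) = D.head (f (n + 1))) ∧
    Function.Injective (fun n => D.head (f n))

/-- `X ⊆ V \ {r}` is `v`-linked in `D(L)`: `v ∈ X` and there is a family
`{P e : e ∈ δ_{D(L)}(X)}` of pairwise edge-disjoint paths of `D(L)`, where `P e`
has `e` as its initial edge and `v` as its terminal vertex. -/
def VLinked (D : MultiDigraph V E) (L : Set E) (r v : V) (X : Set V) : Prop :=
  r ∉ X ∧ v ∈ X ∧
  ∃ P : E → List E,
    (∀ e ∈ D.edgesInto L X, D.IsPathIn L (D.tail e) v (P e) ∧ (P e).head? = some e) ∧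
    (D.edgesInto L X).Pairwise (fun e f => (P e).Disjoint (P f))

/-- `p` is an `r`–`X` path in `D(L)`: a path starting at `r` meeting `X` exactly
in its last vertex. -/
def IsRXPathIn (D : MultiDigraph V E) (L : Set E) (r : V) (X : Set V) (p : List E) : Prop :=
  ∃ hne : p ≠ [],
    D.tail (p.head hne) = r ∧
    D.head (p.getLast hne) ∈ X ∧
    (∀ e ∈ p.dropLast, D.head e ∉ X) ∧
    p.Chain' (fun e f => D.head e = D.tail f) ∧
    (r :: p.map D.head).Nodup ∧
    ∀ e ∈ p, e ∈ L

/-- `X` is fillable in `D(L)`: there is a set `Ps` of pairwise edge-disjoint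
`r`–`X` paths in `D(L)` whose set of terminal edges is exactly `δ_{D(L)}(X)`. -/
def Fillable (D : MultiDigraph V E) (L : Set E) (r : V) (X : Set V) : Prop :=
  ∃ Ps : Set (List E),
    (∀ p ∈ Ps, D.IsRXPathIn L r X p) ∧
    Ps.Pairwise (fun p q => p.Disjoint q) ∧
    {e | ∃ p ∈ Ps, p.getLast? = some e} = D.edgesInto L X

end MultiDigraph

namespace WebLinkage

universe u v w

/-- Every forward orbit of `g` is finite. -/
def OrbFin {V : Type u} (g : V → V) : Prop :=
  ∀ v, (Set.range fun n : ℕ => g^[n] v).Finite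

/-- The vertices of `R` that are reached by an edge from `X`. -/
def nb {V : Type u} (r : V → V → Prop) (R X : Set V) : Set V :=
  {w | w ∈ R ∧ ∃ u ∈ X, r u w}

/-- `g` sends `S` injectively into `Y` backwards along edges, and has finite orbits. -/
def Into {V : Type u} (r : V → V → Prop) (S Y : Set V) (g : V → V) : Prop :=
  (∀ w ∈ S, g w ∈ Y ∧ r (g w) w) ∧ Set.InjOn g S ∧ OrbFin g

/-- A wave of the web `(L, R)`: its boundary is matched into it. -/
def IsWave {V : Type u} (r : V → V → Prop) (L R X : Set V) : Prop :=
  X ⊆ L ∧ ∃ g, Into r (nb r R X) X g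

/-- A web is hindered if some wave has a matching missing one of its vertices. -/
def Hind {V : Type u} (r : V → V → Prop) (L R : Set V) : Prop :=
  ∃ X ⊆ L, ∃ g, Into r (nb r R X) X g ∧ ∃ x ∈ X, x ∉ g '' nb r R X

/-- The vertices of `N` can be linked to each other. -/
def Linked {V : Type u} (r : V → V → Prop) (L R N : Set V) : Prop :=
  ∃ f, Into (flip r) (L ∩ N) (R ∩ N) f

/-- The union of all waves. -/
def maxWave {V : Type u} (r : V → V → Prop) (L R : Set V) : Set V :=
  ⋃₀ {X | IsWave r L R X}

section Basics

variable {V : Type u} {r : V → V → Prop} {L R : Set V}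

theorem finite_orbit_of_apply {g : V → V} {v : V}
    (h : (Set.range fun n : ℕ => g^[n] (g v)).Finite) :
    (Set.range fun n : ℕ => g^[n] v).Finite := by
  refine (h.insert v).subset ?_
  rintro _ ⟨n, rfl⟩
  cases n with
  | zero => exact Or.inl rfl
  | succ n => exact Or.inr ⟨n, by simp⟩

theorem finite_orbit_of_iterate {g : V → V} {v : V} (k : ℕ)
    (h : (Set.range fun n : ℕ => g^[n] (g^[k] v)).Finite) :
    (Set.range fun n : ℕ => g^[n] v).Finite := by
  induction k generalizing v with
  | zero => exact h
  | succ k ih => exact finite_orbit_of_apply (ih (by simpa using h))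

theorem finite_orbit_of_fixed {g : V → V} {v : V} (h : g v = v) :
    (Set.range fun n : ℕ => g^[n] v).Finite := by
  refine (Set.finite_singleton v).subset ?_
  rintro _ ⟨n, rfl⟩
  exact Function.iterate_fixed h n

theorem orbFin_id : OrbFin (id : V → V) := fun _ => finite_orbit_of_fixed rfl

theorem orbFin_of_rank {α : Type v} [Preorder α] [WellFoundedLT α] {ι : Type w} {g : V → V}
    (ρ : V → α) (c : V → ι) (G : ι → V → V) (hG : ∀ i, OrbFin (G i))
    (h : ∀ w, g (g w) = g w ∨ ρ (g w) < ρ w ∨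
      (ρ (g w) ≤ ρ w ∧ c (g w) = c w ∧ g w = G (c w) w)) : OrbFin g := by
  suffices H : ∀ a w, ρ w = a → (Set.range fun n : ℕ => g^[n] w).Finite from
    fun w => H _ w rfl
  intro a
  induction a using WellFoundedLT.induction with
  | ind a ih =>
  rintro w rfl
  by_contra hinf
  have hk : ∀ k, ¬ (Set.range fun n : ℕ => g^[n] (g^[k] w)).Finite :=
    fun k hf => hinf (finite_orbit_of_iterate k hf)
  have key : ∀ n, ρ (g^[n] w) ≤ ρ w ∧ c (g^[n] w) = c w ∧ g^[n] w = (G (c w))^[n] w := by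
    intro n
    induction n with
    | zero => exact ⟨le_rfl, rfl, rfl⟩
    | succ n ihn =>
      obtain ⟨h1, h2, h3⟩ := ihn
      have hk' := hk (n + 1)
      rw [Function.iterate_succ_apply'] at hk' ⊢
      rw [Function.iterate_succ_apply']
      rcases h (g^[n] w) with h4 | h4 | ⟨h4, h5, h6⟩
      · exact absurd (finite_orbit_of_fixed h4) hk'
      · exact absurd (ih _ (h4.trans_le h1) _ rfl) hk'
      · exact ⟨h4.trans h1, h5.trans h2, by rw [← h3, ← h2]; exact h6⟩
  apply hinf
  refine (hG (c w) w).subset ?_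
  rintro _ ⟨n, rfl⟩
  exact ⟨n, (key n).2.2.symm⟩

theorem OrbFin.update [DecidableEq V] {g : V → V} (hg : OrbFin g) (s y : V) :
    OrbFin (Function.update g s y) := by
  set g' := Function.update g s y with hg'
  have avoid : ∀ v, (∀ n, g'^[n] v ≠ s) → (Set.range fun n : ℕ => g'^[n] v).Finite := by
    intro v hv
    refine (hg v).subset ?_
    rintro _ ⟨n, rfl⟩
    refine ⟨n, ?_⟩
    induction n with
    | zero => rfl
    | succ n ih =>
      simp only [Function.iterate_succ_apply'] at ih ⊢
      rw [ih, hg', Function.update_of_ne (hv n)]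
  have hs : (Set.range fun n : ℕ => g'^[n] s).Finite := by
    by_cases h : ∀ n, g'^[n + 1] s ≠ s
    · exact finite_orbit_of_apply (avoid _ fun n => by simpa using h n)
    · push Not at h
      obtain ⟨n, hn⟩ := h
      refine ((Finset.range (n + 1)).finite_toSet.image fun k => g'^[k] s).subset ?_
      rintro _ ⟨k, rfl⟩
      refine ⟨k % (n + 1), by simpa using Nat.mod_lt _ (Nat.succ_pos n), ?_⟩
      exact Function.IsPeriodicPt.iterate_mod_apply hn k
  intro v
  by_cases h : ∀ n, g'^[n] v ≠ s
  · exact avoid v h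
  · push Not at h
    obtain ⟨n, hn⟩ := h
    exact finite_orbit_of_iterate n (by rw [hn]; exact hs)

theorem Into.mono {S S' Y Y' : Set V} {g : V → V} (h : Into r S Y g) (hS : S' ⊆ S)
    (hY : Y ⊆ Y') : Into r S' Y' g :=
  ⟨fun w hw => ⟨hY (h.1 w (hS hw)).1, (h.1 w (hS hw)).2⟩, h.2.1.mono hS, h.2.2⟩

theorem nb_mono {R R' X X' : Set V} (hR : R ⊆ R') (hX : X ⊆ X') : nb r R X ⊆ nb r R' X' :=
  fun _ ⟨h1, u, h2, h3⟩ => ⟨hR h1, u, hX h2, h3⟩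

/-- `Into` only depends on `g` through its values on `S`, up to orbits through `S`. -/
theorem Into.exists_eq_id {S Y : Set V} {g : V → V} (h : Into r S Y g) :
    ∃ g', Into r S Y g' ∧ (∀ w ∈ S, g' w = g w) ∧ ∀ w ∉ S, g' w = w := by
  classical
  let g' : V → V := fun w => if w ∈ S then g w else w
  have h1 : ∀ w ∈ S, g' w = g w := fun w hw => if_pos hw
  have h2 : ∀ w ∉ S, g' w = w := fun w hw => if_neg hw
  refine ⟨g', ⟨fun w hw => by rw [h1 w hw]; exact h.1 w hw, fun a ha b hb hab => ?_, ?_⟩, h1, h2⟩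
  · rw [h1 a ha, h1 b hb] at hab
    exact h.2.1 ha hb hab
  · refine orbFin_of_rank (fun _ => (0 : ℕ)) (fun _ => ()) (fun _ => g) (fun _ => h.2.2) ?_
    intro w
    by_cases hw : w ∈ S
    · exact Or.inr (Or.inr ⟨le_rfl, rfl, h1 w hw⟩)
    · exact Or.inl (by rw [h2 w hw, h2 w hw])

end Basics

section Augment

variable {V : Type u} {r : V → V → Prop} {L R : Set V}

theorem hind_of_into {S X : Set V} {g : V → V} {x : V} (hX : X ⊆ L) (hS : nb r R X ⊆ S)
    (hg : Into r S X g) (hx : x ∈ X) (hxg : x ∉ g '' S) : Hind r L R :=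
  ⟨X, hX, g, hg.mono hS subset_rfl, x, hx, fun h => hxg (Set.image_mono hS h)⟩

theorem Into.update [DecidableEq V] {S Y : Set V} {g : V → V} {w y : V}
    (hg : ∀ s ∈ S, s ≠ w → g s ∈ Y ∧ r (g s) s) (hinj : Set.InjOn g (S \ {w})) (ho : OrbFin g)
    (hy : y ∈ Y) (hyw : r y w) (hyS : ∀ s ∈ S, s ≠ w → g s ≠ y) :
    Into r (insert w S) Y (Function.update g w y) := by
  refine ⟨?_, ?_, ho.update w y⟩
  · intro s hs
    by_cases h : s = w
    · subst h; simpa using ⟨hy, hyw⟩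
    · rw [Function.update_of_ne h]
      exact hg s (hs.resolve_left h) h
  · intro a ha b hb hab
    by_cases h : a = w <;> by_cases h' : b = w
    · rw [h, h']
    · subst h
      rw [Function.update_self, Function.update_of_ne h'] at hab
      exact absurd hab.symm (hyS b (hb.resolve_left h') h')
    · subst h'
      rw [Function.update_self, Function.update_of_ne h] at hab
      exact absurd hab (hyS a (ha.resolve_left h) h)
    · rw [Function.update_of_ne h, Function.update_of_ne h'] at hab
      exact hinj ⟨ha.resolve_left h, h⟩ ⟨hb.resolve_left h', h'⟩ hab

theorem image_update_insert [DecidableEq V] {S : Set V} {g : V → V} {w y : V} :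
    Function.update g w y '' insert w S = insert y (g '' (S \ {w})) := by
  ext z
  constructor
  · rintro ⟨s, hs, rfl⟩
    by_cases h : s = w
    · subst h; simp
    · rw [Function.update_of_ne h]
      exact Or.inr ⟨s, ⟨hs.resolve_left h, h⟩, rfl⟩
  · rintro (rfl | ⟨s, ⟨hs, h⟩, rfl⟩)
    · exact ⟨w, Or.inl rfl, by simp⟩
    · exact ⟨s, Or.inr hs, by rw [Function.update_of_ne h]⟩

/-- The vertices reached from `u` by at most `n` alternating steps. -/
def altReach (r : V → V → Prop) (S : Set V) (g : V → V) (u : V) : ℕ → Set V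
  | 0 => {u}
  | n + 1 => altReach r S g u n ∪ {z | ∃ s ∈ S, g s = z ∧ ∃ y ∈ altReach r S g u n, r y s}

theorem altReach_shift {S Y : Set V} {g : V → V} {u : V} (hg : Into r S Y g) (hu : u ∈ Y)
    (hug : u ∉ g '' S) (n : ℕ) : ∀ y ∈ altReach r S g u n, ∃ k, Into r S Y k ∧
      (∀ s ∈ S, g s ∉ altReach r S g u n → k s = g s) ∧ y ∉ k '' S ∧
      insert y (k '' S) = insert u (g '' S) := by
  classical
  induction n with
  | zero => rintro y rfl; exact ⟨g, hg, fun _ _ _ => rfl, hug, rfl⟩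
  | succ n ih =>
    intro y hy
    by_cases hyn : y ∈ altReach r S g u n
    · obtain ⟨k, h1, h2, h3⟩ := ih y hyn
      exact ⟨k, h1, fun s hs hsn => h2 s hs fun h => hsn (Or.inl h), h3⟩
    · obtain ⟨s, hs, rfl, z, hz, hzs⟩ := hy.resolve_left hyn
      obtain ⟨k, h1, h2, h3, h4⟩ := ih z hz
      have hgs : k s = g s := h2 s hs hyn
      have hzY : z ∈ Y := by
        have : z ∈ insert u (g '' S) := h4 ▸ Or.inl rfl
        rcases this with rfl | ⟨s', hs', rfl⟩
        · exact hu
        · exact (hg.1 s' hs').1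
      have hins : insert s S = S := Set.insert_eq_of_mem hs
      have hI : Into r (insert s S) Y (Function.update k s z) :=
        Into.update (fun s' hs' _ => h1.1 s' hs') (h1.2.1.mono Set.sdiff_subset) h1.2.2 hzY hzs
          fun s' hs' _ h => h3 ⟨s', hs', h⟩
      have him : Function.update k s z '' S = insert z (k '' (S \ {s})) := by
        have := image_update_insert (S := S) (g := k) (w := s) (y := z)
        rwa [hins] at this
      rw [hins] at hI
      refine ⟨_, hI, ?_, ?_, ?_⟩
      · intro s' hs' hn
        have hne : s' ≠ s := by
          rintro rfl
          exact hn (Or.inr ⟨s', hs, rfl, z, hz, hzs⟩)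
        rw [Function.update_of_ne hne]
        exact h2 s' hs' fun h => hn (Or.inl h)
      · rw [him]
        rintro (h | ⟨s', ⟨hs', hne⟩, h⟩)
        · exact h3 ⟨s, hs, by rw [hgs, h]⟩
        · exact hne (h1.2.1 hs' hs (by rw [h, hgs]))
      · rw [him, ← h4, Set.insert_comm]
        congr 1
        rw [← hgs, ← Set.image_insert_eq, Set.insert_sdiff_singleton, hins]

theorem Into.augment {S Y : Set V} {g : V → V} {u w y : V} (hg : Into r S Y g) (hu : u ∈ Y)
    (hug : u ∉ g '' S) {n : ℕ} (hy : y ∈ altReach r S g u n) (hyw : r y w) (hw : w ∉ S) :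
    ∃ k, Into r (insert w S) Y k ∧ k '' insert w S = insert u (g '' S) := by
  classical
  obtain ⟨k, h1, -, h3, h4⟩ := altReach_shift hg hu hug n y hy
  have hyY : y ∈ Y := by
    have : y ∈ insert u (g '' S) := h4 ▸ Or.inl rfl
    rcases this with rfl | ⟨s', hs', rfl⟩
    · exact hu
    · exact (hg.1 s' hs').1
  refine ⟨Function.update k w y, Into.update (fun s hs _ => h1.1 s hs)
    (h1.2.1.mono Set.sdiff_subset) h1.2.2 hyY hyw fun s hs _ h => h3 ⟨s, hs, h⟩, ?_⟩
  rw [image_update_insert, ← h4]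
  congr 2
  exact Set.sdiff_singleton_eq_self hw

theorem altReach_subset {S Y : Set V} {g : V → V} {u : V} (hg : Into r S Y g) (hu : u ∈ Y)
    (n : ℕ) : altReach r S g u n ⊆ Y := by
  induction n with
  | zero => rintro _ rfl; exact hu
  | succ n ih =>
    rintro _ (h | ⟨s, hs, rfl, -⟩)
    · exact ih h
    · exact (hg.1 s hs).1

/-- In an unhindered web, the alternating reach of a free vertex does not stay within `S`. -/
theorem exists_altReach (hΓ : ¬ Hind r L R) {S Y : Set V} {g : V → V} {u : V} (hY : Y ⊆ L)
    (hg : Into r S Y g) (hu : u ∈ Y) (hug : u ∉ g '' S) :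
    ∃ n, ∃ y ∈ altReach r S g u n, ∃ w ∈ R, w ∉ S ∧ r y w := by
  by_contra hcon
  push Not at hcon
  have hsub : ⋃ n, altReach r S g u n ⊆ Y := Set.iUnion_subset fun n => altReach_subset hg hu n
  have hnb : nb r R (⋃ n, altReach r S g u n) ⊆ S := by
    rintro w ⟨hw, y, hy, hyw⟩
    obtain ⟨n, hn⟩ := Set.mem_iUnion.1 hy
    by_contra hwS
    exact hcon n y hn w hw hwS hyw
  refine hΓ ⟨⋃ n, altReach r S g u n, hsub.trans hY, g, ⟨?_, hg.2.1.mono hnb, hg.2.2⟩, u,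
    Set.mem_iUnion.2 ⟨0, rfl⟩, fun h => hug (Set.image_mono hnb h)⟩
  rintro w hw
  refine ⟨?_, (hg.1 w (hnb hw)).2⟩
  obtain ⟨hw', y, hy, hyw⟩ := hw
  obtain ⟨n, hn⟩ := Set.mem_iUnion.1 hy
  exact Set.mem_iUnion.2 ⟨n + 1, Or.inr ⟨w, hnb ⟨hw', y, hy, hyw⟩, rfl, y, hn, hyw⟩⟩

theorem Into.augment_of_not_hind (hΓ : ¬ Hind r L R) {S Y : Set V} {g : V → V} {u w : V}
    (hY : Y ⊆ L) (hg : Into r S Y g) (hu : u ∈ Y) (hug : u ∉ g '' S)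
    (hnb : nb r R Y ⊆ insert w S) :
    w ∉ S ∧ ∃ k, Into r (insert w S) Y k ∧ k '' insert w S = insert u (g '' S) := by
  obtain ⟨n, y, hy, w', hw', hwS, hyw⟩ := exists_altReach hΓ hY hg hu hug
  obtain rfl : w' = w :=
    (hnb ⟨hw', y, altReach_subset hg hu n hy, hyw⟩).resolve_right hwS
  exact ⟨hwS, hg.augment hu hug hy hyw hwS⟩

end Augment

section Glue

variable {V : Type u} {r : V → V → Prop} {L R : Set V}

theorem Into.glue {ι : Type v} [LinearOrder ι] [WellFoundedLT ι] {M Ω : ι → Set V}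
    {G : ι → V → V} (hG : ∀ i, Into r (M i) (Ω i) (G i))
    (h1 : ∀ i j z, z ∈ Ω i → z ∈ M j → ∃ k ≤ i, z ∈ M k)
    (h2 : ∀ i j w, i < j → w ∈ M j → w ∉ M i → G j w ∉ Ω i) :
    ∃ g, Into r (⋃ i, M i) (⋃ i, Ω i) g ∧
      ∀ w i, w ∈ M i → (∀ j < i, w ∉ M j) → g w = G i w := by
  classical
  have hmin : ∀ w, (∃ i, w ∈ M i) → ∃ i, w ∈ M i ∧ ∀ j < i, w ∉ M j := by
    intro w hw
    obtain ⟨i, hi, hi'⟩ := (wellFounded_lt (α := ι)).has_min {i | w ∈ M i} hw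
    exact ⟨i, hi, fun j hj hw => hi' j hw hj⟩
  rcases isEmpty_or_nonempty ι with hι | hι
  · exact ⟨id, by simp [Into, orbFin_id], fun w i => isEmptyElim i⟩
  have : ∀ w, ∃ i, (∃ i, w ∈ M i) → w ∈ M i ∧ ∀ j < i, w ∉ M j := by
    intro w
    by_cases hw : ∃ i, w ∈ M i
    · obtain ⟨i, hi⟩ := hmin w hw
      exact ⟨i, fun _ => hi⟩
    · exact ⟨Classical.arbitrary ι, fun h => absurd h hw⟩
  choose idx hidx using this
  have huniq : ∀ w i, w ∈ M i → (∀ j < i, w ∉ M j) → idx w = i := by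
    intro w i hi hi'
    obtain ⟨h3, h4⟩ := hidx w ⟨i, hi⟩
    rcases lt_trichotomy (idx w) i with h | h | h
    · exact absurd h3 (hi' _ h)
    · exact h
    · exact absurd hi (h4 _ h)
  let g : V → V := fun w => if ∃ i, w ∈ M i then G (idx w) w else w
  have hg1 : ∀ w, (∃ i, w ∈ M i) → g w = G (idx w) w := fun w hw => if_pos hw
  have hg2 : ∀ w, ¬ (∃ i, w ∈ M i) → g w = w := fun w hw => if_neg hw
  refine ⟨g, ⟨?_, ?_, ?_⟩, ?_⟩
  · intro w hw
    have hw' := Set.mem_iUnion.1 hw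
    rw [hg1 w hw']
    have := (hG _).1 w (hidx w hw').1
    exact ⟨Set.mem_iUnion.2 ⟨_, this.1⟩, this.2⟩
  · intro a ha b hb hab
    have ha' := Set.mem_iUnion.1 ha
    have hb' := Set.mem_iUnion.1 hb
    rw [hg1 a ha', hg1 b hb'] at hab
    rcases lt_trichotomy (idx a) (idx b) with h | h | h
    · exact absurd (hab ▸ ((hG _).1 a (hidx a ha').1).1)
        (h2 _ _ b h (hidx b hb').1 ((hidx b hb').2 _ h))
    · rw [h] at hab
      exact (hG _).2.1 (h ▸ (hidx a ha').1) (hidx b hb').1 hab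
    · exact absurd (hab.symm ▸ ((hG _).1 b (hidx b hb').1).1)
        (h2 _ _ a h (hidx a ha').1 ((hidx a ha').2 _ h))
  · refine orbFin_of_rank idx idx G (fun i => (hG i).2.2) ?_
    intro w
    by_cases hw : ∃ i, w ∈ M i
    · by_cases hgw : ∃ i, g w ∈ M i
      · have hΩ : g w ∈ Ω (idx w) := by
          rw [hg1 w hw]; exact ((hG _).1 w (hidx w hw).1).1
        obtain ⟨j, hj⟩ := hgw
        obtain ⟨k, hk, hkM⟩ := h1 _ _ _ hΩ hj
        have hle : idx (g w) ≤ idx w := by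
          by_contra hlt
          push Not at hlt
          exact (hidx (g w) ⟨j, hj⟩).2 k (hk.trans_lt hlt) hkM
        rcases hle.lt_or_eq with h | h
        · exact Or.inr (Or.inl h)
        · exact Or.inr (Or.inr ⟨hle, h, hg1 w hw⟩)
      · exact Or.inl (hg2 _ hgw)
    · exact Or.inl (by rw [hg2 w hw, hg2 w hw])
  · intro w i hi hi'
    rw [hg1 w ⟨i, hi⟩, huniq w i hi hi']

theorem nb_iUnion {ι : Type v} (X : ι → Set V) : nb r R (⋃ i, X i) = ⋃ i, nb r R (X i) := by
  ext w
  simp only [nb, Set.mem_iUnion, Set.mem_ofPred_eq]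
  constructor
  · rintro ⟨h, u, ⟨i, hi⟩, hu⟩; exact ⟨i, h, u, hi, hu⟩
  · rintro ⟨i, h, u, hi, hu⟩; exact ⟨h, u, ⟨i, hi⟩, hu⟩

theorem subset_nb (hr : ∀ v, r v v) {X : Set V} {z : V} (hz : z ∈ X) (hzR : z ∈ R) :
    z ∈ nb r R X := ⟨hzR, z, hz, hr z⟩

theorem isWave_iUnion (hr : ∀ v, r v v) {ι : Type v} (X : ι → Set V)
    (hX : ∀ i, IsWave r L R (X i)) : IsWave r L R (⋃ i, X i) := by
  obtain ⟨_, _⟩ := exists_wellFoundedLT ι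
  choose hL G hG using hX
  refine ⟨Set.iUnion_subset hL, ?_⟩
  rw [nb_iUnion]
  obtain ⟨g, hg, -⟩ := Into.glue hG (fun i j z hz hzj => ⟨i, le_rfl, subset_nb hr hz hzj.1⟩)
    (fun i j w _ hwj hwi h => hwi ⟨hwj.1, _, h, ((hG j).1 w hwj).2⟩)
  exact ⟨g, hg⟩

theorem isWave_maxWave (hr : ∀ v, r v v) : IsWave r L R (maxWave r L R) := by
  rw [maxWave, Set.sUnion_eq_iUnion]
  exact isWave_iUnion hr _ fun i => i.2

theorem IsWave.subset_maxWave {X : Set V} (h : IsWave r L R X) : X ⊆ maxWave r L R :=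
  Set.subset_sUnion_of_mem h

/-- The web that remains beyond a maximal wave is unhindered. -/
theorem not_hind_beyond_maxWave (hr : ∀ v, r v v) :
    ¬ Hind r (L \ maxWave r L R) (R \ nb r R (maxWave r L R)) := by
  rintro ⟨X', hX', g', hg', x, hx, -⟩
  obtain ⟨hXL, g, hg⟩ := isWave_maxWave (L := L) (R := R) hr
  set X := maxWave r L R with hXdef
  have hw : IsWave r L R (X ∪ X') := by
    refine ⟨Set.union_subset hXL (hX'.trans Set.sdiff_subset), ?_⟩
    have key := Into.glue (r := r) (ι := Bool)
      (M := fun b => bif b then nb r (R \ nb r R X) X' else nb r R X)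
      (Ω := fun b => bif b then X' else X) (G := fun b => bif b then g' else g)
      (by rintro (_ | _) <;> assumption) ?_ ?_
    · obtain ⟨k, hk, -⟩ := key
      refine ⟨k, hk.mono ?_ ?_⟩
      · rintro w ⟨hwR, u, hu, huw⟩
        by_cases hwX : w ∈ nb r R X
        · exact Set.mem_iUnion.2 ⟨false, hwX⟩
        · rcases hu with hu | hu
          · exact absurd ⟨hwR, u, hu, huw⟩ hwX
          · exact Set.mem_iUnion.2 ⟨true, ⟨hwR, hwX⟩, u, hu, huw⟩
      · refine Set.iUnion_subset ?_
        rintro (_ | _)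
        · exact Set.subset_union_left
        · exact Set.subset_union_right
    · intro i j z hz hzj
      have hzR : z ∈ R := by
        rcases j with _ | _
        · exact hzj.1
        · exact hzj.1.1
      by_cases hzX : z ∈ nb r R X
      · exact ⟨false, Bool.false_le _, hzX⟩
      · rcases i with _ | _
        · exact absurd (subset_nb hr hz hzR) hzX
        · exact ⟨true, le_rfl, subset_nb hr hz ⟨hzR, hzX⟩⟩
    · rintro (_ | _) (_ | _) w hij hwj hwi
      · exact absurd hij (lt_irrefl _)
      · exact (hX' (hg'.1 w hwj).1).2
      · exact absurd hij (by decide)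
      · exact absurd hij (lt_irrefl _)
  exact (hX' hx).2 (hw.subset_maxWave (Or.inr hx))

end Glue

section Deletion

variable {V : Type u} {r : V → V → Prop} {L R : Set V}

/-- A vertex whose deletion creates a hindrance lies on the boundary of a wave. -/
theorem exists_isWave_of_hind_diff (hΓ : ¬ Hind r L R) {v : V}
    (h : Hind r (L \ {v}) (R \ {v})) : ∃ X, IsWave r L R X ∧ v ∈ nb r R X := by
  obtain ⟨X, hX, g, hg, x, hx, hxg⟩ := h
  have hXL := hX.trans Set.sdiff_subset
  have hsub : nb r R X ⊆ insert v (nb r (R \ {v}) X) := by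
    rintro w ⟨hw, u, hu, huw⟩
    by_cases h : w = v
    · exact Or.inl h
    · exact Or.inr ⟨⟨hw, h⟩, u, hu, huw⟩
  refine ⟨X, ?_, ?_⟩
  · obtain ⟨-, g', hg', -⟩ := hg.augment_of_not_hind hΓ hXL hx hxg hsub
    exact ⟨hXL, g', hg'.mono hsub subset_rfl⟩
  · by_contra hvX
    refine hΓ (hind_of_into hXL ?_ hg hx hxg)
    intro w hw
    exact (hsub hw).resolve_left fun h => hvX (h ▸ hw)

theorem not_hind_of_not_hind_diff (hr : ∀ v, r v v) {v : V} (hv : v ∈ R)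
    (h : ¬ Hind r (L \ {v}) (R \ {v})) : ¬ Hind r L R := by
  classical
  rintro ⟨X, hX, g, hg, x, hx, hxg⟩
  have hnb : nb r (R \ {v}) (X \ {v}) ⊆ nb r R X := nb_mono Set.sdiff_subset Set.sdiff_subset
  have hvn : v ∉ nb r (R \ {v}) (X \ {v}) := fun h => h.1.2 rfl
  by_cases hvX : v ∈ X
  swap
  · have hnb' : nb r (R \ {v}) X ⊆ nb r R X := nb_mono Set.sdiff_subset subset_rfl
    exact h (hind_of_into (fun z hz => ⟨hX hz, fun e => hvX (e ▸ hz)⟩) hnb' hg hx hxg)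
  have hXv : X \ {v} ⊆ L \ {v} := Set.sdiff_subset_sdiff_left hX
  have hvb : v ∈ nb r R X := subset_nb hr hvX hv
  by_cases hvr : v ∈ g '' nb r R X
  swap
  · -- `v` itself is missed, so `g v` is missed after the deletion
    have hI : Into r (nb r (R \ {v}) (X \ {v})) (X \ {v}) g :=
      ⟨fun w hw => ⟨⟨(hg.1 w (hnb hw)).1, fun e => hvr ⟨w, hnb hw, e⟩⟩, (hg.1 w (hnb hw)).2⟩,
        hg.2.1.mono hnb, hg.2.2⟩
    refine h (hind_of_into hXv subset_rfl hI (x := g v)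
      ⟨(hg.1 v hvb).1, fun e => hvr ⟨v, hvb, e⟩⟩ ?_)
    rintro ⟨w, hw, e⟩
    exact hvn (hg.2.1 (hnb hw) hvb e ▸ hw)
  obtain ⟨w, hw, hwv⟩ := hvr
  have hxv : x ≠ v := fun e => hxg ⟨w, hw, by rw [hwv, e]⟩
  set S := nb r (R \ {v}) (X \ {v}) \ {w} with hS
  have hSn : S ⊆ nb r R X := Set.sdiff_subset.trans hnb
  have hI : Into r S (X \ {v}) g := by
    refine ⟨fun z hz => ⟨⟨(hg.1 z (hSn hz)).1, fun e => ?_⟩, (hg.1 z (hSn hz)).2⟩,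
      hg.2.1.mono hSn, hg.2.2⟩
    exact hz.2 (hg.2.1 (hSn hz) hw (by rw [hwv]; exact e))
  have hsub : nb r (R \ {v}) (X \ {v}) ⊆ insert w S := fun z hz => by
    by_cases e : z = w
    · exact Or.inl e
    · exact Or.inr ⟨hz, e⟩
  by_cases hvv : g v = v
  · have hwv' : w = v := hg.2.1 hw hvb (by rw [hwv, hvv])
    refine h (hind_of_into hXv (S := S) ?_ hI ⟨hx, hxv⟩ fun h => hxg (Set.image_mono hSn h))
    exact fun z hz => ⟨hz, fun e => hz.1.2 (e.trans hwv')⟩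
  · have hgv : g v ∉ g '' S := by
      rintro ⟨z, hz, e⟩
      exact hvn (hg.2.1 (hSn hz) hvb e ▸ hz.1)
    obtain ⟨-, g', hg', himg⟩ := hI.augment_of_not_hind h hXv ⟨(hg.1 v hvb).1, hvv⟩ hgv hsub
    refine h (hind_of_into hXv hsub hg' ⟨hx, hxv⟩ ?_)
    rw [himg]
    rintro (e | h)
    · exact hxg ⟨v, hvb, e.symm⟩
    · exact hxg (Set.image_mono hSn h)

theorem IsWave.hind_diff {X : Set V} (hX : IsWave r L R X) {t : V} (ht : t ∈ nb r R X)
    (htX : t ∉ X) : Hind r (L \ {t}) (R \ {t}) := by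
  obtain ⟨hXL, g, hg⟩ := hX
  have hnb : nb r (R \ {t}) X ⊆ nb r R X := nb_mono Set.sdiff_subset subset_rfl
  refine ⟨X, fun z hz => ⟨hXL hz, fun e => htX (e ▸ hz)⟩, g, hg.mono hnb subset_rfl, g t,
    (hg.1 t ht).1, ?_⟩
  rintro ⟨w, hw, e⟩
  exact hw.1.2 (hg.2.1 (hnb hw) ht e)

end Deletion

section Span

variable {V : Type u} {r : V → V → Prop} {L R : Set V}

theorem IsWave.diff_singleton (hr : ∀ v, r v v) {X : Set V} (hX : IsWave r L R X) {t : V}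
    (ht : t ∈ R) (h : ¬ Hind r (L \ {t}) (R \ {t})) :
    IsWave r (L \ {t}) (R \ {t}) (X \ {t}) := by
  obtain ⟨hXL, g, hg⟩ := hX
  have hnb : nb r (R \ {t}) (X \ {t}) ⊆ nb r R X := nb_mono Set.sdiff_subset Set.sdiff_subset
  have htn : t ∉ nb r (R \ {t}) (X \ {t}) := fun h => h.1.2 rfl
  have hXt : X \ {t} ⊆ L \ {t} := Set.sdiff_subset_sdiff_left hXL
  refine ⟨hXt, ?_⟩
  have simple : (∀ w ∈ nb r (R \ {t}) (X \ {t}), g w ≠ t) →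
      ∃ g, Into r (nb r (R \ {t}) (X \ {t})) (X \ {t}) g := fun hne =>
    ⟨g, fun w hw => ⟨⟨(hg.1 w (hnb hw)).1, hne w hw⟩, (hg.1 w (hnb hw)).2⟩,
      hg.2.1.mono hnb, hg.2.2⟩
  by_contra hcon
  have : ∃ w ∈ nb r (R \ {t}) (X \ {t}), g w = t := by
    by_contra hcon2
    push Not at hcon2
    exact hcon (simple hcon2)
  obtain ⟨w, hw, hwt⟩ := this
  have htX : t ∈ X := hwt ▸ (hg.1 w (hnb hw)).1
  have htb : t ∈ nb r R X := subset_nb hr htX ht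
  have hgt : g t ≠ t := fun e => htn (hg.2.1 (hnb hw) htb (by rw [hwt, e]) ▸ hw)
  set S := nb r (R \ {t}) (X \ {t}) \ {w} with hS
  have hSn : S ⊆ nb r R X := Set.sdiff_subset.trans hnb
  have hI : Into r S (X \ {t}) g := by
    refine ⟨fun z hz => ⟨⟨(hg.1 z (hSn hz)).1, fun e => ?_⟩, (hg.1 z (hSn hz)).2⟩,
      hg.2.1.mono hSn, hg.2.2⟩
    exact hz.2 (hg.2.1 (hSn hz) (hnb hw) (by rw [hwt]; exact e))
  have hsub : nb r (R \ {t}) (X \ {t}) ⊆ insert w S := fun z hz => by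
    by_cases e : z = w
    · exact Or.inl e
    · exact Or.inr ⟨hz, e⟩
  have hgtS : g t ∉ g '' S := by
    rintro ⟨z, hz, e⟩
    exact htn (hg.2.1 (hSn hz) htb e ▸ hz.1)
  obtain ⟨-, g', hg', -⟩ := hI.augment_of_not_hind h hXt ⟨(hg.1 t htb).1, hgt⟩ hgtS hsub
  exact hcon ⟨g', hg'.mono hsub subset_rfl⟩

theorem mem_nb_maxWave_diff (hr : ∀ v, r v v) {X : Set V} (hX : IsWave r L R X) {t w : V}
    (ht : t ∈ R) (h : ¬ Hind r (L \ {t}) (R \ {t})) (hw : w ∈ nb r R X) (hwt : w ≠ t) :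
    w ∈ nb r (R \ {t}) (maxWave r (L \ {t}) (R \ {t})) := by
  have hmax := (hX.diff_singleton hr ht h).subset_maxWave
  by_cases hwX : w ∈ X
  · exact subset_nb hr (hmax ⟨hwX, hwt⟩) ⟨hw.1, hwt⟩
  · have h1 := hX.hind_diff hw hwX
    have h2 : Hind r ((L \ {w}) \ {t}) ((R \ {w}) \ {t}) := by
      by_contra h2
      exact not_hind_of_not_hind_diff (L := L \ {w}) (R := R \ {w}) hr (v := t)
          ⟨ht, fun e => hwt e.symm⟩ h2 h1
    rw [sdiff_right_comm, sdiff_right_comm (c := R)] at h2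
    obtain ⟨Y, hY, hwY⟩ := exists_isWave_of_hind_diff h h2
    exact nb_mono subset_rfl hY.subset_maxWave hwY

/-- Deleting `F` leaves an unhindered web. -/
def Indep (r : V → V → Prop) (L R F : Set V) : Prop := ¬ Hind r (L \ F) (R \ F)

theorem Indep.of_insert (hr : ∀ v, r v v) {F : Set V} {v : V} (hv : v ∈ R)
    (h : Indep r L R (insert v F)) : Indep r L R F := by
  by_cases hvF : v ∈ F
  · rwa [Set.insert_eq_of_mem hvF] at h
  · refine not_hind_of_not_hind_diff hr (v := v) ⟨hv, hvF⟩ ?_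
    rwa [Set.sdiff_sdiff, Set.sdiff_sdiff, Set.union_singleton]

theorem Indep.mono (hr : ∀ v, r v v) {F G : Set V} (hFG : F ⊆ G) (hG : G.Finite) (hGR : G ⊆ R)
    (h : Indep r L R G) : Indep r L R F := by
  have key : ∀ H : Set V, H.Finite → H ⊆ R → Indep r L R (F ∪ H) → Indep r L R F := by
    intro H hH
    induction H, hH using Set.Finite.induction_on with
    | empty => intro _ h; simpa using h
    | insert _ _ ih =>
      intro hR h
      rw [Set.union_insert] at h
      exact ih ((Set.subset_insert _ _).trans hR) (h.of_insert hr (hR (Or.inl rfl)))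
  exact key G hG hGR (by rwa [Set.union_eq_self_of_subset_left hFG])

/-- The maximal wave after deleting `F`. -/
def waveOf (r : V → V → Prop) (L R F : Set V) : Set V := maxWave r (L \ F) (R \ F)

/-- The boundary, together with `F`, of the maximal wave after deleting `F`. -/
def spanOf (r : V → V → Prop) (L R F : Set V) : Set V := nb r (R \ F) (waveOf r L R F) ∪ F

theorem spanOf_mono_insert (hr : ∀ v, r v v) {F : Set V} {t : V} (ht : t ∈ R)
    (h : Indep r L R (insert t F)) : spanOf r L R F ⊆ spanOf r L R (insert t F) := by
  by_cases htF : t ∈ F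
  · rw [Set.insert_eq_of_mem htF]
  rintro w (hw | hw)
  · by_cases hwt : w = t
    · exact Or.inr (Or.inl hwt)
    · have := mem_nb_maxWave_diff hr (isWave_maxWave hr) (L := L \ F) (R := R \ F)
        (t := t) (w := w) ⟨ht, htF⟩
        (by rwa [Set.sdiff_sdiff, Set.sdiff_sdiff, Set.union_singleton]) hw hwt
      rw [Set.sdiff_sdiff, Set.sdiff_sdiff, Set.union_singleton] at this
      exact Or.inl this
  · exact Or.inr (Or.inr hw)

theorem spanOf_mono (hr : ∀ v, r v v) {F G : Set V} (hFG : F ⊆ G) (hG : G.Finite) (hGR : G ⊆ R)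
    (h : Indep r L R G) : spanOf r L R F ⊆ spanOf r L R G := by
  have key : ∀ H : Set V, H.Finite → H ⊆ R → Indep r L R (F ∪ H) →
      spanOf r L R F ⊆ spanOf r L R (F ∪ H) := by
    intro H hH
    induction H, hH using Set.Finite.induction_on with
    | empty => intro _ h; simp
    | insert _ _ ih =>
      intro hR h
      rw [Set.union_insert] at h ⊢
      have hv := hR (Or.inl rfl)
      exact (ih ((Set.subset_insert _ _).trans hR) (h.of_insert hr hv)).trans
        (spanOf_mono_insert hr hv h)
  have := key G hG hGR
  rw [Set.union_eq_self_of_subset_left hFG] at this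
  exact this h

theorem mem_nb_waveOf {F : Set V} {v : V} (hF : Indep r L R F)
    (hv : ¬ Indep r L R (insert v F)) : v ∈ nb r (R \ F) (waveOf r L R F) := by
  have h2 : Hind r ((L \ F) \ {v}) ((R \ F) \ {v}) := by
    rw [Set.sdiff_sdiff, Set.sdiff_sdiff, Set.union_singleton]
    exact not_not.1 hv
  obtain ⟨Y, hY, hwY⟩ := exists_isWave_of_hind_diff hF h2
  exact nb_mono subset_rfl hY.subset_maxWave hwY

/-- A matching of the boundary of the maximal wave, extended by the identity on `F`. -/
theorem exists_into_spanOf (hr : ∀ v, r v v) (F : Set V) :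
    ∃ g, Into r (spanOf r L R F) (waveOf r L R F ∪ F) g ∧ (∀ w ∈ F, g w = w) ∧
      ∀ w ∈ spanOf r L R F, g w ∈ F → w ∈ F := by
  obtain ⟨hX, g0, hg0⟩ := isWave_maxWave (L := L \ F) (R := R \ F) hr
  obtain ⟨g, hg, -, hid⟩ := hg0.exists_eq_id
  have hF : ∀ w ∈ F, g w = w := fun w hw => hid w fun h => h.1.2 hw
  have hne : ∀ w ∈ spanOf r L R F, g w ∈ F → w ∈ F := fun w hw hgw =>
    hw.resolve_left fun h => (hX (hg.1 w h).1).2 hgw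
  refine ⟨g, ⟨?_, ?_, hg.2.2⟩, hF, hne⟩
  · rintro w (hw | hw)
    · exact ⟨Or.inl (hg.1 w hw).1, (hg.1 w hw).2⟩
    · rw [hF w hw]; exact ⟨Or.inr hw, hr w⟩
  · intro x hx y hy hxy
    by_cases hxF : x ∈ F
    · have hyF : y ∈ F := hne y hy (by rw [← hxy, hF x hxF]; exact hxF)
      rwa [hF x hxF, hF y hyF] at hxy
    · by_cases hyF : y ∈ F
      · exact absurd (hne x hx (by rw [hxy, hF y hyF]; exact hyF)) hxF
      · exact hg.2.1 (hx.resolve_right hxF) (hy.resolve_right hyF) hxy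

/-- The reflexive case of stability: waves in the deletions of finite subsets of an independent
set `Q` fit together to a wave that avoids the vertices of `Q` never covered. -/
theorem waveOf_subset_maxWave (hr : ∀ v, r v v) {Q T : Set V} (hQR : Q ⊆ R) (hQL : Q ⊆ L)
    (hQ : ∀ F : Finset V, ↑F ⊆ Q → Indep r L R F)
    (hT : T = {q ∈ Q | ∀ F : Finset V, ↑F ⊆ Q → q ∉ waveOf r L R F})
    {G₀ : Finset V} (hG₀ : ↑G₀ ⊆ Q) :
    (waveOf r L R G₀ ∪ G₀) \ T ⊆ maxWave r (L \ T) (R \ T) := by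
  classical
  have hch : ∀ k, ∃ F : Finset V, ↑F ⊆ Q ∧ (k ∈ Q → k ∉ T → k ∈ waveOf r L R F) := by
    intro k
    by_cases hk : k ∈ Q ∧ k ∉ T
    · have h := hk.2
      rw [hT] at h
      have : ∃ F : Finset V, ↑F ⊆ Q ∧ k ∈ waveOf r L R F := by
        by_contra hcon
        push Not at hcon
        exact h ⟨hk.1, hcon⟩
      obtain ⟨F, hF, hkF⟩ := this
      exact ⟨F, hF, fun _ _ => hkF⟩
    · exact ⟨∅, by simp, fun h1 h2 => absurd ⟨h1, h2⟩ hk⟩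
  choose K hKQ hK using hch
  obtain ⟨F, rfl, hFs⟩ : ∃ F : ℕ → Finset V, F 0 = G₀ ∧
      ∀ n, F (n + 1) = F n ∪ (F n).biUnion K :=
    ⟨fun n => Nat.rec G₀ (fun _ F => F ∪ F.biUnion K) n, rfl, fun _ => rfl⟩
  have hFQ : ∀ n, (F n : Set V) ⊆ Q := by
    intro n
    induction n with
    | zero => exact hG₀
    | succ n ih =>
      rw [hFs, Finset.coe_union, Finset.coe_biUnion]
      exact Set.union_subset ih (Set.iUnion₂_subset fun k _ => hKQ k)
  have hmono : Monotone F := monotone_nat_of_le_succ fun n => by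
    rw [hFs]; exact Finset.subset_union_left
  have hKF : ∀ n, ∀ k ∈ F n, K k ⊆ F (n + 1) := by
    intro n k hk
    rw [hFs]
    exact (Finset.subset_biUnion_of_mem K hk).trans Finset.subset_union_right
  have hTw : ∀ n t, t ∈ T → t ∉ waveOf r L R (F n) := by
    intro n t ht
    rw [hT] at ht
    exact ht.2 (F n) (hFQ n)
  have hwL : ∀ n, waveOf r L R (F n) ⊆ L \ F n := fun n => (isWave_maxWave hr).1
  choose G hG hGid hGF using fun n => exists_into_spanOf (L := L) (R := R) hr (F n : Set V)
  have hspan : ∀ n w u, w ∈ R → u ∈ waveOf r L R (F n) → r u w → w ∈ spanOf r L R (F n) := by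
    intro n w u hw hu huw
    by_cases hwF : w ∈ (F n : Set V)
    · exact Or.inr hwF
    · exact Or.inl ⟨⟨hw, hwF⟩, u, hu, huw⟩
  have hspanR : ∀ n, spanOf r L R (F n) ⊆ R :=
    fun n => Set.union_subset (fun w hw => hw.1.1) ((hFQ n).trans hQR)
  obtain ⟨g, hg, hgG⟩ := Into.glue (M := fun n => spanOf r L R (F n))
    (Ω := fun n => waveOf r L R (F n) ∪ F n) hG
    (by
      rintro i j z (hz | hz) hzj
      · exact ⟨i, le_rfl, hspan i z z (hspanR j hzj) hz (hr z)⟩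
      · exact ⟨i, le_rfl, Or.inr hz⟩)
    (by
      rintro i j w hij hwj hwi (h | h)
      · exact hwi (hspan i w _ (hspanR j hwj) h ((hG j).1 w hwj).2)
      · have hwF := hGF j w hwj (hmono hij.le h)
        rw [hGid j w hwF] at h
        exact hwi (Or.inr h))
  set X := (⋃ n, (waveOf r L R (F n) ∪ F n)) \ T with hXdef
  have hw : IsWave r (L \ T) (R \ T) X := by
    refine ⟨?_, g, ?_, ?_, hg.2.2⟩
    · rintro x ⟨hx, hxT⟩
      obtain ⟨n, hn | hn⟩ := Set.mem_iUnion.1 hx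
      · exact ⟨(hwL n hn).1, hxT⟩
      · exact ⟨hQL (hFQ n hn), hxT⟩
    all_goals
      have hsub : nb r (R \ T) X ⊆ ⋃ n, spanOf r L R (F n) := by
        rintro w ⟨hwR, u, ⟨hu, huT⟩, huw⟩
        obtain ⟨n, hn | hn⟩ := Set.mem_iUnion.1 hu
        · exact Set.mem_iUnion.2 ⟨n, hspan n w u hwR.1 hn huw⟩
        · have hu' := hK u (hFQ n hn) huT
          have hwK : w ∈ spanOf r L R (K u) := by
            by_cases hwF : w ∈ (K u : Set V)
            · exact Or.inr hwF
            · exact Or.inl ⟨⟨hwR.1, hwF⟩, u, hu', huw⟩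
          exact Set.mem_iUnion.2 ⟨n + 1, spanOf_mono hr (Finset.coe_subset.2 (hKF n u hn))
            (F (n + 1)).finite_toSet ((hFQ _).trans hQR) (hQ _ (hFQ _)) hwK⟩
    · intro w hw
      refine ⟨⟨(hg.1 w (hsub hw)).1, fun hT' => ?_⟩, (hg.1 w (hsub hw)).2⟩
      have hex := Set.mem_iUnion.1 (hsub hw)
      obtain ⟨i, hi, hmin⟩ : ∃ i, w ∈ spanOf r L R (F i) ∧ ∀ j < i, w ∉ spanOf r L R (F j) :=
        ⟨Nat.find hex, Nat.find_spec hex, fun j hj => Nat.find_min hex hj⟩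
      have hgi := hgG w i hi hmin
      have hgF : G i w ∈ (F i : Set V) :=
        ((hG i).1 w hi).1.resolve_left (hTw i _ (hgi ▸ hT'))
      rw [hgi, hGid i w (hGF i w hi hgF)] at hT'
      exact hw.1.2 hT'
    · exact hg.2.1.mono hsub
  refine Set.Subset.trans ?_ hw.subset_maxWave
  exact Set.sdiff_subset_sdiff_left fun x hx => Set.mem_iUnion.2 ⟨0, hx⟩

end Span

section SafePath

variable {V : Type u} {r : V → V → Prop} {L R : Set V}

/-- A bijective matching between finite sets can be reversed. -/
theorem Into.flip_of_finite {S Y : Set V} {g : V → V} (hg : Into r S Y g) (hY : Y.Finite)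
    (hS : S.Finite) (him : Y ⊆ g '' S) : ∃ f, Into (flip r) Y S f := by
  classical
  have him' : ∀ y, ∃ s, y ∈ Y → s ∈ S ∧ g s = y := fun y => by
    by_cases hy : y ∈ Y
    · obtain ⟨s, hs, e⟩ := him hy
      exact ⟨s, fun _ => ⟨hs, e⟩⟩
    · exact ⟨y, fun h => absurd h hy⟩
  choose f hf' using him'
  have hfS : ∀ {y}, y ∈ Y → f y ∈ S := fun hy => (hf' _ hy).1
  have hf : ∀ {y}, y ∈ Y → g (f y) = y := fun hy => (hf' _ hy).2
  let f' : V → V := fun y => if y ∈ Y then f y else y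
  have h1 : ∀ y ∈ Y, f' y = f y := fun y hy => if_pos hy
  have h2 : ∀ y ∉ Y, f' y = y := fun y hy => if_neg hy
  refine ⟨f', fun y hy => ?_, fun a ha b hb hab => ?_, fun v => ?_⟩
  · rw [h1 y hy]
    refine ⟨hfS hy, ?_⟩
    have := (hg.1 _ (hfS hy)).2
    rwa [hf hy] at this
  · rw [h1 a ha, h1 b hb] at hab
    rw [← hf ha, ← hf hb, hab]
  · refine ((hY.union hS).union (Set.finite_singleton v)).subset ?_
    rintro _ ⟨n, rfl⟩
    induction n with
    | zero => exact Or.inr rfl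
    | succ n ih =>
      simp only [Function.iterate_succ_apply'] at ih ⊢
      by_cases h : f'^[n] v ∈ Y
      · rw [h1 _ h]; exact Or.inl (Or.inr (hfS h))
      · rw [h2 _ h]; exact ih

theorem altReach_id_mono {S S' : Set V} (hS : S ⊆ S') (u : V) (n : ℕ) :
    altReach r S id u n ⊆ altReach r S' id u n := by
  induction n with
  | zero => exact subset_rfl
  | succ n ih =>
    rintro z (hz | ⟨s, hs, rfl, y, hy, hys⟩)
    · exact Or.inl (ih hz)
    · exact Or.inr ⟨s, hS hs, rfl, y, ih hy, hys⟩

/-- A walk step inside the web whose end lies in `Q`. -/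
def StepTo (r : V → V → Prop) (L Q : Set V) (u v : V) : Prop := u ∈ L ∧ v ∈ Q ∧ r u v

theorem exists_finset_altReach {Q : Set V} {a z : V}
    (h : Relation.ReflTransGen (StepTo r L Q) a z) (hz : z ∈ L) :
    ∃ P : Finset V, ↑P ⊆ Q ∩ L ∧ ∃ n, z ∈ altReach r P id a n := by
  classical
  induction h with
  | refl => exact ⟨∅, by simp, 0, rfl⟩
  | tail _ hs ih =>
    rename_i y z _
    obtain ⟨P, hP, n, hn⟩ := ih hs.1
    refine ⟨insert z P, ?_, n + 1, Or.inr ⟨z, by simp, rfl, y, ?_, hs.2.2⟩⟩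
    · rw [Finset.coe_insert]
      exact Set.insert_subset ⟨hs.2.1, hz⟩ hP
    · exact altReach_id_mono (by simp) a n hn

theorem exists_maximal_indep (hr : ∀ v, r v v) (hΓ : Indep r L R ∅) (a : V) (L' : Set V) :
    ∃ Q ⊆ R, (∀ q ∈ Q, Relation.ReflTransGen (StepTo r L' Q) a q) ∧
      (∀ F : Finset V, ↑F ⊆ Q → Indep r L R F) ∧
      ∀ v ∈ R, v ∉ Q → ∀ u, (u = a ∨ u ∈ Q) → u ∈ L' → r u v →
        ∃ F : Finset V, ↑F ⊆ Q ∧ ¬ Indep r L R (insert v F) := by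
  classical
  obtain ⟨Q, hQ⟩ : ∃ Q, Maximal (· ∈ {Q : Set V | Q ⊆ R ∧
      (∀ q ∈ Q, Relation.ReflTransGen (StepTo r L' Q) a q) ∧
      ∀ F : Finset V, ↑F ⊆ Q → Indep r L R F}) Q := by
    apply zorn_subset
    intro c hc hchain
    rcases c.eq_empty_or_nonempty with rfl | hne
    · refine ⟨∅, ⟨Set.empty_subset _, by simp, fun F hF => ?_⟩, by simp⟩
      rw [Set.subset_empty_iff.1 hF]
      exact hΓ
    · refine ⟨⋃₀ c, ⟨Set.sUnion_subset fun Q hQ => (hc hQ).1, ?_, ?_⟩,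
        fun Q hQ => Set.subset_sUnion_of_mem hQ⟩
      · rintro q ⟨Q, hQ, hq⟩
        refine Relation.ReflTransGen.mono ?_ _ _ ((hc hQ).2.1 q hq)
        exact fun x y h => ⟨h.1, ⟨Q, hQ, h.2.1⟩, h.2.2⟩
      · intro F hF
        obtain ⟨Q, hQ, hFQ⟩ := hchain.directedOn.exists_mem_subset_of_finite_of_subset_sUnion
          hne F.finite_toSet hF
        exact (hc hQ).2.2 F hFQ
  obtain ⟨hQR, hQ1, hQ2⟩ := hQ.prop
  refine ⟨Q, hQR, hQ1, hQ2, fun v hv hvQ u hu huL huv => ?_⟩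
  by_contra hcon
  push Not at hcon
  have hstep : ∀ x y, StepTo r L' Q x y → StepTo r L' (insert v Q) x y :=
    fun x y h => ⟨h.1, Or.inr h.2.1, h.2.2⟩
  have hreach : ∀ q ∈ Q, Relation.ReflTransGen (StepTo r L' (insert v Q)) a q :=
    fun q hq => Relation.ReflTransGen.mono hstep _ _ (hQ1 q hq)
  have hmem : insert v Q ∈ {Q : Set V | Q ⊆ R ∧
      (∀ q ∈ Q, Relation.ReflTransGen (StepTo r L' Q) a q) ∧
      ∀ F : Finset V, ↑F ⊆ Q → Indep r L R F} := by
    refine ⟨Set.insert_subset hv hQR, ?_, ?_⟩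
    · rintro q (rfl | hq)
      · refine Relation.ReflTransGen.tail ?_ ⟨huL, Or.inl rfl, huv⟩
        rcases hu with rfl | hu
        · exact Relation.ReflTransGen.refl
        · exact hreach u hu
      · exact hreach q hq
    · intro F hF
      have h1 : ↑(F.erase v) ⊆ Q := by
        intro x hx
        rw [Finset.mem_coe, Finset.mem_erase] at hx
        exact (hF hx.2).resolve_left hx.1
      refine (hcon _ h1).mono hr ?_ ((F.erase v).finite_toSet.insert v)
        (Set.insert_subset hv (h1.trans hQR))
      intro x hx
      by_cases hxv : x = v
      · exact Or.inl hxv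
      · exact Or.inr (Finset.mem_coe.2 (Finset.mem_erase.2 ⟨hxv, hx⟩))
  exact hvQ (hQ.le_of_ge hmem (Set.subset_insert v Q) (Or.inl rfl))

/-- Every source of an unhindered web lies on a finite linkable set whose deletion leaves an
unhindered web. -/
theorem exists_finite_safe (hr : ∀ v, r v v) (hΓ : ¬ Hind r L R) {a : V} (haL : a ∈ L)
    (haR : a ∉ R) : ∃ P : Set V, P.Finite ∧ a ∈ P ∧ Linked r L R P ∧
      ¬ Hind r (L \ P) (R \ P) := by
  classical
  have hΔ : Indep r (L \ {a}) R ∅ := by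
    rw [Indep, Set.sdiff_empty, Set.sdiff_empty]
    rintro ⟨X, hX, h⟩
    exact hΓ ⟨X, hX.trans Set.sdiff_subset, h⟩
  obtain ⟨Q, hQR, hQ1, hQ2, hQ3⟩ := exists_maximal_indep hr hΔ a L
  have haQ : a ∉ Q := fun h => haR (hQR h)
  by_cases hQL : Q ⊆ L
  · exfalso
    have hQL' : Q ⊆ L \ {a} := fun q hq => ⟨hQL hq, fun e => haQ (e ▸ hq)⟩
    obtain ⟨T, hT⟩ : ∃ T, T = {q ∈ Q | ∀ F : Finset V, ↑F ⊆ Q →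
      q ∉ waveOf r (L \ {a}) R F} := ⟨_, rfl⟩
    have hsub := fun G (hG : ↑G ⊆ Q) => waveOf_subset_maxWave hr hQR hQL' hQ2 hT (G₀ := G) hG
    have hTQ : T ⊆ Q := by rw [hT]; exact fun _ h => h.1
    obtain ⟨hXL, g0, hg0⟩ := isWave_maxWave (L := (L \ {a}) \ T) (R := R \ T) hr
    have hwave : ∀ G : Finset V, ↑G ⊆ Q →
        waveOf r (L \ {a}) R G ⊆ maxWave r ((L \ {a}) \ T) (R \ T) := by
      intro G hG x hx
      refine hsub G hG ⟨Or.inl hx, fun hxT => ?_⟩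
      rw [hT] at hxT
      exact hxT.2 G hG hx
    have hQT : Q \ T ⊆ maxWave r ((L \ {a}) \ T) (R \ T) := by
      rintro q ⟨hq, hqT⟩
      exact hsub {q} (by simpa using hq) ⟨Or.inr (by simp), hqT⟩
    obtain ⟨g, hg, -, hid⟩ := exists_into_spanOf (L := L \ {a}) (R := R) hr T
    change Into r (nb r (R \ T) (maxWave r ((L \ {a}) \ T) (R \ T)) ∪ T)
      (maxWave r ((L \ {a}) \ T) (R \ T) ∪ T) g at hg
    have haX : a ∉ maxWave r ((L \ {a}) \ T) (R \ T) ∪ T := by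
      rintro (h | h)
      · exact (hXL h).1.2 rfl
      · exact haQ (hTQ h)
    refine hΓ (hind_of_into (X := insert a (maxWave r ((L \ {a}) \ T) (R \ T) ∪ T)) ?_ ?_
      (hg.mono subset_rfl (Set.subset_insert _ _)) (Set.mem_insert _ _) ?_)
    · refine Set.insert_subset haL (Set.union_subset ?_ (hTQ.trans hQL))
      exact fun x hx => (hXL hx).1.1
    · rintro w ⟨hwR, u, hu, huw⟩
      by_cases hwT : w ∈ T
      · exact Or.inr hwT
      left
      by_cases huX : u ∈ maxWave r ((L \ {a}) \ T) (R \ T)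
      · exact ⟨⟨hwR, hwT⟩, u, huX, huw⟩
      by_cases hwQ : w ∈ Q
      · exact subset_nb hr (hQT ⟨hwQ, hwT⟩) ⟨hwR, hwT⟩
      · have hu' : u = a ∨ u ∈ Q := by
          rcases hu with h | h | h
          · exact Or.inl h
          · exact absurd h huX
          · exact Or.inr (hTQ h)
        have huL : u ∈ L := by
          rcases hu' with rfl | h
          · exact haL
          · exact hQL h
        obtain ⟨F, hF, hdep⟩ := hQ3 w hwR hwQ u hu' huL huw
        obtain ⟨-, y, hy, hyw⟩ := mem_nb_waveOf (hQ2 F hF) hdep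
        exact ⟨⟨hwR, hwT⟩, y, hwave F hF hy, hyw⟩
    · rintro ⟨w, hw, e⟩
      exact haX (e ▸ (hg.1 w hw).1)
  · obtain ⟨b, hbQ, hbL⟩ := Set.not_subset.1 hQL
    have hba : b ≠ a := fun e => haQ (e ▸ hbQ)
    obtain ⟨y, hay, hyb⟩ : ∃ y, Relation.ReflTransGen (StepTo r L Q) a y ∧ StepTo r L Q y b := by
      rcases (hQ1 b hbQ).cases_tail with h | h
      · exact absurd h.symm hba.symm
      · exact h
    obtain ⟨P, hP, n, hn⟩ := exists_finset_altReach hay hyb.1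
    have hI : Into r (P : Set V) (insert a (P : Set V)) id :=
      ⟨fun w hw => ⟨Or.inr hw, hr w⟩, Set.injOn_id _, orbFin_id⟩
    have haP : a ∉ id '' (P : Set V) := by
      rw [Set.image_id]; exact fun h => haQ (hP h).1
    obtain ⟨g, hg, him⟩ := hI.augment (Or.inl rfl) haP hn hyb.2.2
      (fun h => hbL (hP h).2)
    rw [Set.image_id] at him
    obtain ⟨f, hf⟩ := hg.flip_of_finite (P.finite_toSet.insert a) (P.finite_toSet.insert b)
      him.ge
    refine ⟨insert a (insert b P), (P.finite_toSet.insert b).insert a, Or.inl rfl, ⟨f, ?_⟩, ?_⟩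
    · refine hf.mono ?_ ?_
      · rintro x ⟨hxL, rfl | rfl | hx⟩
        · exact Or.inl rfl
        · exact absurd hxL hbL
        · exact Or.inr hx
      · rintro x (rfl | hx)
        · exact ⟨hQR hbQ, Or.inr (Or.inl rfl)⟩
        · exact ⟨hQR (hP hx).1, Or.inr (Or.inr hx)⟩
    · have h := hQ2 (insert b P) (by
        rw [Finset.coe_insert]; exact Set.insert_subset hbQ fun x hx => (hP hx).1)
      rw [Indep, Finset.coe_insert, Set.sdiff_sdiff, Set.singleton_union] at h
      rwa [Set.sdiff_insert_of_notMem (s := R) haR]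

end SafePath

section Tower

variable {V : Type u} {r : V → V → Prop} {L R : Set V}

/-- Hindrances beyond the stages of an increasing tower, each augmented by one vertex so that all
newly bounded vertices are covered, combine to a single hindrance. -/
theorem hind_of_tower (hr : ∀ v, r v v) {K : Type v} [LinearOrder K] [WellFoundedLT K]
    {N X : K → Set V} {o : K → Option V} {G : K → V → V}
    (hX : ∀ i, X i ⊆ L \ N i)
    (hG : ∀ i, Into r (nb r (R \ N i) (X i) ∪ {v | o i = some v}) (X i) (G i))
    (ho : ∀ i v, o i = some v → v ∈ R ∩ N i)
    (hcov : ∀ i v, v ∈ R → v ∈ N i → (∃ u ∈ X i, r u v) → ∃ j, o j = some v)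
    (hN : ∀ i j, i < j → N i ⊆ N j)
    (hcl : ∀ i j, i < j → ∀ w ∈ nb r (R \ N i) (X i) ∪ {v | o i = some v},
      (w ∈ N j ↔ G i w ∈ N j))
    {i₀ : K} {x : V} (ho₀ : o i₀ = none) (hx : x ∈ X i₀)
    (hxG : x ∉ G i₀ '' nb r (R \ N i₀) (X i₀)) (hxN : ∀ j, i₀ < j → x ∈ N j) :
    Hind r L R := by
  classical
  set S : K → Set V := fun i => nb r (R \ N i) (X i) with hS
  have hSnot : ∀ i w, w ∈ S i → w ∉ N i := fun i w hw => hw.1.2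
  have hSG : ∀ i w, w ∈ S i → G i w ∈ X i ∧ r (G i w) w := fun i w hw => (hG i).1 w (Or.inl hw)
  have hSi : ∀ i w z, w ∈ R → w ∉ N i → z ∈ X i → r z w → w ∈ S i :=
    fun i w z h1 h2 h3 h4 => ⟨⟨h1, h2⟩, z, h3, h4⟩
  have hXS : ∀ i z, z ∈ X i → z ∈ R → z ∈ S i := fun i z hz hzR =>
    hSi i z z hzR (hX i hz).2 hz (hr z)
  have hNle : ∀ i j, i ≤ j → N i ⊆ N j := fun i j hij => by
    rcases hij.lt_or_eq with h | rfl
    · exact hN i j h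
    · exact subset_rfl
  have hprof : ∀ i j w, w ∈ S i → (w ∈ N j ↔ G i w ∈ N j) := by
    intro i j w hw
    rcases lt_or_ge i j with h | h
    · exact hcl i j h w (Or.inl hw)
    · exact iff_of_false (fun h' => hSnot i w hw (hNle j i h h'))
        (fun h' => (hX i (hSG i w hw).1).2 (hNle j i h h'))
  set W := nb r R (⋃ i, X i) with hW
  let K1 : V → K → Prop := fun w i => (∀ j, w ∉ S j) ∧ o i = some w
  let K2 : V → K → Prop := fun w i => w ∈ S i ∧ ∀ j, i < j → w ∈ N j
  let K3 : V → K → Prop := fun w i => w ∈ S i ∧ (∀ j, ¬ K2 w j) ∧ ∀ j < i, w ∉ S j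
  have hex : ∀ w, ∃ p : ℕ × K, w ∈ W →
      (p.1 = 2 ∧ K1 w p.2) ∨ (p.1 = 0 ∧ K2 w p.2) ∨ (p.1 = 1 ∧ K3 w p.2) := by
    intro w
    by_cases hw : w ∈ W
    swap
    · exact ⟨(0, i₀), fun h => absurd h hw⟩
    by_cases h2 : ∃ i, K2 w i
    · obtain ⟨i, hi⟩ := h2
      exact ⟨(0, i), fun _ => Or.inr (Or.inl ⟨rfl, hi⟩)⟩
    by_cases hwS : ∃ i, w ∈ S i
    · obtain ⟨i, hi, hi'⟩ := (wellFounded_lt (α := K)).has_min {i | w ∈ S i} hwS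
      refine ⟨(1, i), fun _ => Or.inr (Or.inr ⟨rfl, hi, fun j hj => h2 ⟨j, hj⟩, ?_⟩)⟩
      exact fun j hj hw => hi' j hw hj
    · push Not at hwS
      obtain ⟨hwR, z, hz, hzw⟩ := hw
      obtain ⟨i, hi⟩ := Set.mem_iUnion.1 hz
      have hwN : w ∈ N i := by
        by_contra h
        exact hwS i (hSi i w z hwR h hi hzw)
      obtain ⟨j, hj⟩ := hcov i w hwR hwN ⟨z, hi, hzw⟩
      exact ⟨(2, j), fun _ => Or.inl ⟨rfl, hwS, hj⟩⟩
  choose p hp using hex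
  let g : V → V := fun w => if w ∈ W then G (p w).2 w else w
  have hg1 : ∀ w, w ∈ W → g w = G (p w).2 w := fun w hw => if_pos hw
  have hg2 : ∀ w, w ∉ W → g w = w := fun w hw => if_neg hw
  have hS' : ∀ w, w ∈ W → w ∈ S (p w).2 ∪ {v | o (p w).2 = some v} := by
    intro w hw
    rcases hp w hw with ⟨-, h⟩ | ⟨-, h⟩ | ⟨-, h⟩
    · exact Or.inr h.2
    · exact Or.inl h.1
    · exact Or.inl h.1
  have hgX : ∀ w, w ∈ W → g w ∈ X (p w).2 ∧ r (g w) w := by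
    intro w hw
    rw [hg1 w hw]
    exact (hG _).1 w (hS' w hw)
  -- vertices assigned at their top stage have images with the same top stage
  have htop : ∀ w, w ∈ W → (p w).1 ≠ 1 → ∀ j, (p w).2 < j → g w ∈ N j := by
    intro w hw hw1 j hj
    rw [hg1 w hw]
    rcases hp w hw with ⟨-, h⟩ | ⟨-, h⟩ | ⟨h, -⟩
    · exact (hcl _ j hj w (Or.inr h.2)).1 (hN _ j hj (ho _ w h.2).2)
    · exact (hcl _ j hj w (Or.inl h.1)).1 (h.2 j hj)
    · exact absurd h hw1
  have hmix : ∀ w i, w ∈ W → (p w).1 = 1 → g w ∈ X i → (∀ j, i < j → g w ∈ N j) → False := by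
    intro w i hw hw1 hgi hgN
    have h3 : K3 w (p w).2 := by
      rcases hp w hw with ⟨h, -⟩ | ⟨h, -⟩ | ⟨-, h⟩
      · omega
      · omega
      · exact h
    have hpr := fun j => hprof _ j w h3.1
    rw [← hg1 w hw] at hpr
    refine h3.2.1 i ⟨hSi i w (g w) hw.1 ?_ hgi (hgX w hw).2, fun j hj => (hpr j).2 (hgN j hj)⟩
    exact fun h => (hX i hgi).2 ((hpr i).1 h)
  have hk : ∀ w, w ∈ W → (p w).1 = 1 → K3 w (p w).2 := by
    intro w hw hw1
    rcases hp w hw with ⟨h, -⟩ | ⟨h, -⟩ | ⟨-, h⟩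
    · omega
    · omega
    · exact h
  have hWsub : nb r R (⋃ i, X i) ⊆ W := subset_rfl
  refine ⟨⋃ i, X i, Set.iUnion_subset fun i => (hX i).trans Set.sdiff_subset, g,
    ⟨fun w hw => ⟨Set.mem_iUnion.2 ⟨_, (hgX w hw).1⟩, (hgX w hw).2⟩, ?_, ?_⟩, x,
    Set.mem_iUnion.2 ⟨i₀, hx⟩, ?_⟩
  · intro a ha b hb hab
    have heq : (p a).2 = (p b).2 → a = b := fun h => by
      rw [hg1 a ha, hg1 b hb, ← h] at hab
      exact (hG _).2.1 (hS' a ha) (h ▸ hS' b hb) hab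
    by_cases ha1 : (p a).1 = 1 <;> by_cases hb1 : (p b).1 = 1
    · apply heq
      have main : ∀ a b, a ∈ W → b ∈ W → g a = g b → (p a).1 = 1 → (p b).1 = 1 →
          ¬ (p a).2 < (p b).2 := by
        intro a b ha hb hab ha1 hb1 hlt
        have h3 := hk b hb hb1
        have hbN : b ∈ N (p a).2 := by
          by_contra h
          exact h3.2.2 _ hlt (hSi _ b (g b) hb.1 h (hab ▸ (hgX a ha).1) (hgX b hb).2)
        exact hSnot _ b h3.1 (hN _ _ hlt hbN)
      exact le_antisymm (not_lt.1 (main b a hb ha hab.symm hb1 ha1))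
        (not_lt.1 (main a b ha hb hab ha1 hb1))
    · exact (hmix a (p b).2 ha ha1 (hab ▸ (hgX b hb).1) (hab ▸ htop b hb hb1)).elim
    · exact (hmix b (p a).2 hb hb1 (hab ▸ (hgX a ha).1) (hab ▸ htop a ha ha1)).elim
    · apply heq
      rcases lt_trichotomy (p a).2 (p b).2 with h | h | h
      · exact absurd (hab ▸ htop a ha ha1 _ h) (hX _ (hgX b hb).1).2
      · exact h
      · exact absurd (hab.symm ▸ htop b hb hb1 _ h) (hX _ (hgX a ha).1).2
  · refine orbFin_of_rank (fun w => toLex (p w)) (fun w => (p w).2) G (fun i => (hG i).2.2) ?_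
    intro w
    by_cases hw : w ∈ W
    swap
    · exact Or.inl (by rw [hg2 w hw, hg2 w hw])
    by_cases hz : g w ∈ W
    swap
    · exact Or.inl (hg2 _ hz)
    right
    have hzS := hXS _ _ (hgX w hw).1 hz.1
    have huniq : ∀ i j, K2 (g w) i → K2 (g w) j → ¬ i < j :=
      fun i j hi hj hij => hSnot _ _ hj.1 (hi.2 j hij)
    rcases hp w hw with ⟨hw1, -⟩ | ⟨hw1, h⟩ | ⟨hw1, h⟩
    · left
      rw [Prod.Lex.toLex_lt_toLex]
      left
      rcases hp _ hz with ⟨-, h'⟩ | ⟨h', -⟩ | ⟨h', -⟩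
      · exact absurd hzS (h'.1 _)
      · omega
      · omega
    · have hK : K2 (g w) (p w).2 := ⟨hzS, fun j hj => htop w hw (by omega) j hj⟩
      rcases hp _ hz with ⟨-, h'⟩ | ⟨h', h''⟩ | ⟨-, h'⟩
      · exact absurd hzS (h'.1 _)
      · have e : (p (g w)).2 = (p w).2 :=
          le_antisymm (not_lt.1 (huniq _ _ hK h'')) (not_lt.1 (huniq _ _ h'' hK))
        right
        refine ⟨le_of_eq ?_, e, hg1 w hw⟩
        exact congrArg toLex (Prod.ext (h'.trans hw1.symm) e)
      · exact absurd hK (h'.2.1 _)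
    · rcases hp _ hz with ⟨-, h'⟩ | ⟨h', -⟩ | ⟨h', h''⟩
      · exact absurd hzS (h'.1 _)
      · left
        rw [Prod.Lex.toLex_lt_toLex]
        left
        omega
      · have hle : (p (g w)).2 ≤ (p w).2 := not_lt.1 fun hlt => h''.2.2 _ hlt hzS
        rcases hle.lt_or_eq with hlt | e
        · left
          rw [Prod.Lex.toLex_lt_toLex]
          exact Or.inr ⟨h'.trans hw1.symm, hlt⟩
        · right
          refine ⟨le_of_eq ?_, e, hg1 w hw⟩
          exact congrArg toLex (Prod.ext (h'.trans hw1.symm) e)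
  · rintro ⟨w, hw, e⟩
    replace hw : w ∈ W := hw
    by_cases hw1 : (p w).1 = 1
    · exact hmix w i₀ hw hw1 (e ▸ hx) (e ▸ hxN)
    · have hi : (p w).2 = i₀ := by
        rcases lt_trichotomy (p w).2 i₀ with h | h | h
        · exact absurd (e ▸ htop w hw hw1 _ h) (hX _ hx).2
        · exact h
        · exact absurd (hxN _ h) (e ▸ (hX _ (hgX w hw).1).2)
      rcases hp w hw with ⟨-, h⟩ | ⟨-, h⟩ | ⟨h, -⟩
      · have := h.2
        rw [hi, ho₀] at this
        exact absurd this (by simp)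
      · exact hxG ⟨w, hi ▸ h.1, by rw [← e, hg1 w hw, hi]⟩
      · exact hw1 h

end Tower

open Cardinal
section Club

variable {V : Type u} {r : V → V → Prop} {L R : Set V}

theorem Hind.exists_augmentable (h : Hind r L R) : ∃ X ⊆ L, ∃ x ∈ X, ∃ g,
    Into r (nb r R X) X g ∧ x ∉ g '' nb r R X ∧
    ∀ v ∉ nb r R X, (∃ u ∈ X, r u v) → ∃ g', Into r (insert v (nb r R X)) X g' := by
  obtain ⟨X', hX', g, hg, x, hx, hxg⟩ := h
  set S' := nb r R X' with hS'
  set X := ⋃ n, altReach r S' g x n with hXdef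
  have hXX' : X ⊆ X' := Set.iUnion_subset fun n => altReach_subset hg hx n
  have hxX : x ∈ X := Set.mem_iUnion.2 ⟨0, rfl⟩
  have hSS' : nb r R X ⊆ S' := nb_mono subset_rfl hXX'
  have hI : Into r (nb r R X) X g := by
    refine ⟨fun w hw => ⟨?_, (hg.1 w (hSS' hw)).2⟩, hg.2.1.mono hSS', hg.2.2⟩
    obtain ⟨-, y, hy, hyw⟩ := id hw
    obtain ⟨n, hn⟩ := Set.mem_iUnion.1 hy
    exact Set.mem_iUnion.2 ⟨n + 1, Or.inr ⟨w, hSS' hw, rfl, y, hn, hyw⟩⟩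
  have hxS : x ∉ g '' nb r R X := fun h => hxg (Set.image_mono hSS' h)
  refine ⟨X, hXX'.trans hX', x, hxX, g, hI, hxS, ?_⟩
  rintro v hv ⟨u, hu, huv⟩
  have hsub : ∀ n, altReach r S' g x n ⊆ altReach r (nb r R X) g x n := by
    intro n
    induction n with
    | zero => exact subset_rfl
    | succ n ih =>
      rintro z (hz | ⟨s, hs, rfl, y, hy, hys⟩)
      · exact Or.inl (ih hz)
      · exact Or.inr ⟨s, ⟨hs.1, y, Set.mem_iUnion.2 ⟨n, hy⟩, hys⟩, rfl, y, ih hy, hys⟩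
  obtain ⟨n, hn⟩ := Set.mem_iUnion.1 hu
  obtain ⟨g', hg', -⟩ := hI.augment hxX hxS (hsub n hn) huv hv
  exact ⟨g', hg'⟩

/-- `N` contains the value of `F` at each of its finite subsets. -/
def ClosedUnder (F : Finset V → Set V) (N : Set V) : Prop :=
  ∀ e : Finset V, ↑e ⊆ N → F e ⊆ N

/-- A family of sets is null if some operation with values smaller than `κ` has no closed
members of that family of size less than `κ`. -/
def ClubNull (κ : Cardinal.{u}) (S : Set (Set V)) : Prop :=
  ∃ F : Finset V → Set V, (∀ e, #(F e) < κ) ∧ ∀ N ∈ S, #N < κ → ¬ ClosedUnder F N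

variable {κ : Cardinal.{u}}

theorem ClubNull.mono {S S' : Set (Set V)} (h : ClubNull κ S) (hS : S' ⊆ S) : ClubNull κ S' := by
  obtain ⟨F, h1, h2⟩ := h
  exact ⟨F, h1, fun N hN => h2 N (hS hN)⟩

theorem ClubNull.union (hκ : ℵ₀ ≤ κ) {S S' : Set (Set V)} (h : ClubNull κ S)
    (h' : ClubNull κ S') : ClubNull κ (S ∪ S') := by
  obtain ⟨F, h1, h2⟩ := h
  obtain ⟨F', h1', h2'⟩ := h'
  refine ⟨fun e => F e ∪ F' e,
    fun e => (mk_union_le _ _).trans_lt (add_lt_of_lt hκ (h1 e) (h1' e)), ?_⟩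
  rintro N (hN | hN) hlt hcl
  · exact h2 N hN hlt fun e he => Set.subset_union_left.trans (hcl e he)
  · exact h2' N hN hlt fun e he => Set.subset_union_right.trans (hcl e he)

theorem mk_iUnion_lt (hκ : κ.IsRegular) {ι : Type u} (hι : #ι < κ) {A : ι → Set V}
    (hA : ∀ i, #(A i) < κ) : #(⋃ i, A i : Set V) < κ :=
  (card_iUnion_lt_iff_forall_of_isRegular hκ hι).2 hA

theorem ClubNull.diagonal (hκ : κ.IsRegular) {S : V → Set (Set V)} (h : ∀ v, ClubNull κ (S v)) :
    ClubNull κ {N | ∃ v ∈ N, N ∈ S v} := by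
  classical
  choose F h1 h2 using h
  refine ⟨fun e => ⋃ v : e, ⋃ e' : e.powerset, F v e', fun e => ?_, ?_⟩
  · exact mk_iUnion_lt hκ ((mk_lt_aleph0).trans_le hκ.aleph0_le) fun v =>
      mk_iUnion_lt hκ ((mk_lt_aleph0).trans_le hκ.aleph0_le) fun e' => h1 _ _
  · rintro N ⟨v, hv, hN⟩ hlt hcl
    refine h2 v N hN hlt fun e he x hx => hcl (insert v e) ?_ ?_
    · rw [Finset.coe_insert]; exact Set.insert_subset hv he
    · exact Set.mem_iUnion.2 ⟨⟨v, Finset.mem_insert_self v e⟩, Set.mem_iUnion.2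
        ⟨⟨e, Finset.mem_powerset.2 (Finset.subset_insert v e)⟩, hx⟩⟩

theorem exists_closed_of_not_clubNull {S : Set (Set V)} (h : ¬ ClubNull κ S)
    {F : Finset V → Set V} (hF : ∀ e, #(F e) < κ) : ∃ N ∈ S, #N < κ ∧ ClosedUnder F N := by
  by_contra hcon
  push Not at hcon
  exact h ⟨F, hF, hcon⟩

/-- Dependent choice along a well-order. -/
theorem exists_recursion {K : Type v} [LinearOrder K] [WellFoundedLT K] {α : Type w}
    (P : ∀ i : K, (Set.Iio i → α) → α → Prop) (h : ∀ i f, ∃ y, P i f y) :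
    ∃ f : K → α, ∀ i, P i (fun j => f j) (f i) := by
  choose c hc using h
  let f : K → α := (wellFounded_lt (α := K)).fix fun i ih => c i fun j => ih j j.2
  refine ⟨f, fun i => ?_⟩
  have : f i = c i fun j => f j := (wellFounded_lt (α := K)).fix_eq _ i
  rw [this]
  exact hc _ _

theorem mk_Iio_ord_toType_lt (i : κ.ord.ToType) : #(Set.Iio i) < κ := by
  have h := mk_Iio_lt i (by simp)
  rwa [mk_ord_toType] at h

theorem exists_bookkeeping (hκ : ℵ₀ ≤ κ) : ∃ b : κ.ord.ToType → κ.ord.ToType × κ.ord.ToType,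
    ∀ p i, ∃ j, i < j ∧ b j = p := by
  have hcard : #κ.ord.ToType = κ := mk_ord_toType κ
  obtain ⟨e⟩ : Nonempty (κ.ord.ToType ≃ (κ.ord.ToType × κ.ord.ToType) × κ.ord.ToType) := by
    rw [← Cardinal.eq]
    simp [hcard, mul_eq_self hκ]
  refine ⟨fun i => (e i).1, fun p i => ?_⟩
  by_contra hcon
  push Not at hcon
  have hinj : Function.Injective fun k => (⟨e.symm (p, k), by
      by_contra h
      exact hcon _ (not_le.1 h) (by simp)⟩ : Set.Iic i) := by
    intro a b hab
    have := congrArg Subtype.val hab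
    simpa using this
  have h1 := mk_le_of_injective hinj
  rw [hcard, ← Set.Iio_insert] at h1
  have h2 : #(Set.Iio i) < κ := mk_Iio_ord_toType_lt i
  exact absurd (h1.trans (mk_insert_le)) (not_le.2
    (add_lt_of_lt hκ h2 (one_lt_aleph0.trans_le hκ)))

theorem exists_enumeration {K : Type u} (A : Set V) (hA : #A ≤ #K) : ∃ e : K → Option V,
    (∀ k v, e k = some v → v ∈ A) ∧ ∀ v ∈ A, ∃ k, e k = some v := by
  classical
  obtain ⟨f⟩ := hA
  refine ⟨fun k => if h : ∃ v : A, f v = k then some h.choose else none, fun k v hk => ?_,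
    fun v hv => ⟨f ⟨v, hv⟩, ?_⟩⟩
  · by_cases h : ∃ v : A, f v = k
    · simp only [dif_pos h, Option.some.injEq] at hk
      exact hk ▸ h.choose.2
    · simp only [dif_neg h] at hk
      exact absurd hk (by simp)
  · have h : ∃ v' : A, f v' = f ⟨v, hv⟩ := ⟨_, rfl⟩
    simp only [dif_pos h, f.injective h.choose_spec]

/-- Deleting a small set closed under a suitable operation preserves unhinderedness. -/
theorem exists_club (hr : ∀ v, r v v) (hκ : κ.IsRegular) (hΓ : ¬ Hind r L R) :
    ∃ F : Finset V → Set V, (∀ e, #(F e) < κ) ∧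
      ∀ N : Set V, #N < κ → ClosedUnder F N → ¬ Hind r (L \ N) (R \ N) := by
  classical
  have hκ0 := hκ.aleph0_le
  set S : Set (Set V) := {N | Hind r (L \ N) (R \ N)} with hSdef
  suffices hnull : ClubNull κ S by
    obtain ⟨F, h1, h2⟩ := hnull
    exact ⟨F, h1, fun N hN hcl hh => h2 N hh hN hcl⟩
  by_contra hS
  have hV : Nonempty V := by
    by_contra hV
    refine hS ⟨fun _ => ∅, fun _ => by simpa using hκ.pos, ?_⟩
    rintro N ⟨-, -, -, -, x, -⟩
    exact absurd ⟨x⟩ hV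
  have hdata : ∀ N : Set V, ∃ (X : Set V) (x : V) (g : V → V) (gv : V → V → V), N ∈ S →
      X ⊆ L \ N ∧ x ∈ X ∧ Into r (nb r (R \ N) X) X g ∧ x ∉ g '' nb r (R \ N) X ∧
      ∀ v ∈ N, (∃ u ∈ X, r u v) → Into r (insert v (nb r (R \ N) X)) X (gv v) := by
    intro N
    by_cases hN : N ∈ S
    · obtain ⟨X, hX, x, hx, g, hg, hxg, haug⟩ := Hind.exists_augmentable hN
      have : ∀ v, ∃ g', v ∈ N → (∃ u ∈ X, r u v) → Into r (insert v (nb r (R \ N) X)) X g' := by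
        intro v
        by_cases hv : v ∈ N ∧ ∃ u ∈ X, r u v
        · obtain ⟨g', hg'⟩ := haug v (fun h => h.1.2 hv.1) hv.2
          exact ⟨g', fun _ _ => hg'⟩
        · exact ⟨id, fun h1 h2 => absurd ⟨h1, h2⟩ hv⟩
      choose gv hgv using this
      exact ⟨X, x, g, gv, fun _ => ⟨hX, hx, hg, hxg, hgv⟩⟩
    · exact ⟨∅, hV.some, id, fun _ => id, fun h => absurd h hN⟩
  choose X x g gv hD using hdata
  let T : Set V → Set V := fun N => {v | v ∈ R ∧ v ∈ N ∧ ∃ u ∈ X N, r u v}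
  let Pop : Set V := {v | ¬ ClubNull κ {N | N ∈ S ∧ v ∈ T N}}
  let S' : Set (Set V) := {N | N ∈ S ∧ T N ⊆ Pop}
  have hdiff : ClubNull κ {N | N ∈ S ∧ N ∉ S'} := by
    have h := ClubNull.diagonal hκ (V := V) (S := fun v => {N | N ∈ S ∧ v ∈ T N ∧ v ∉ Pop}) ?_
    · refine h.mono ?_
      rintro N ⟨hN, hN'⟩
      have : ¬ T N ⊆ Pop := fun h => hN' ⟨hN, h⟩
      obtain ⟨v, hv, hvP⟩ := Set.not_subset.1 this
      exact ⟨v, hv.2.1, hN, hv, hvP⟩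
    · intro v
      by_cases hv : v ∈ Pop
      · exact ⟨fun _ => ∅, fun _ => by simpa using hκ.pos, fun N hN => absurd hv hN.2.2⟩
      · exact (not_not.1 hv).mono fun N hN => ⟨hN.1, hN.2.1⟩
  have hnot : ∀ o : Option V, (∀ v, o = some v → v ∈ Pop) →
      ¬ ClubNull κ {N | N ∈ S' ∧ ∀ v, o = some v → v ∈ T N} := by
    intro o ho hnull
    have hu := hnull.union hκ0 hdiff
    cases o with
    | none =>
      refine hS (hu.mono fun N hN => ?_)
      by_cases h : N ∈ S'
      · exact Or.inl ⟨h, by simp⟩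
      · exact Or.inr ⟨hN, h⟩
    | some v =>
      refine ho v rfl (hu.mono fun N hN => ?_)
      by_cases h : N ∈ S'
      · refine Or.inl ⟨h, fun v' hv' => ?_⟩
        rw [← Option.some.inj hv']; exact hN.2
      · exact Or.inr ⟨hN.1, h⟩
  let K := κ.ord.ToType
  have hK : #K = κ := mk_ord_toType κ
  have hIio : ∀ i : K, #(Set.Iio i) < κ := fun i => mk_Iio_ord_toType_lt i
  obtain ⟨b, hb⟩ := exists_bookkeeping hκ0
  have henum : ∀ A : Set V, ∃ e : K → Option V, #A < κ →
      (∀ k v, e k = some v → v ∈ A) ∧ ∀ v ∈ A, ∃ k, e k = some v := by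
    intro A
    by_cases hA : #A < κ
    · obtain ⟨e, he⟩ := exists_enumeration (K := K) A (by rw [hK]; exact hA.le)
      exact ⟨e, fun _ => he⟩
    · exact ⟨fun _ => none, fun h => absurd h hA⟩
  choose enum henum using henum
  let Sh : Set V × Option V → Set V := fun p => nb r (R \ p.1) (X p.1) ∪ {v | p.2 = some v}
  let gh : Set V × Option V → V → V := fun p => p.2.elim (g p.1) (gv p.1)
  let Good : Set V × Option V → Prop := fun p =>
    p.1 ∈ S' ∧ #p.1 < κ ∧ ∀ v, p.2 = some v → v ∈ T p.1
  have hgh : ∀ p, Good p → Into r (Sh p) (X p.1) (gh p) := by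
    rintro ⟨N, o⟩ ⟨h1, -, h3⟩
    obtain ⟨-, -, h4, -, h5⟩ := hD N h1.1
    cases o with
    | none => exact h4.mono (by rintro w (hw | hw); exacts [hw, absurd hw (by simp)]) subset_rfl
    | some v =>
      have hv := h3 v rfl
      refine (h5 v hv.2.1 hv.2.2).mono ?_ subset_rfl
      rintro w (hw | hw)
      · exact Or.inr hw
      · exact Or.inl (Option.some.inj hw).symm
  have hTlt : ∀ N : Set V, #N < κ → #(T N) < κ := fun N hN =>
    (mk_le_mk_of_subset fun v hv => hv.2.1).trans_lt hN
  let tgt : ∀ i : K, (Set.Iio i → Set V × Option V) → Option V := fun i h =>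
    if hb : (b i).1 < i then enum (T (h ⟨(b i).1, hb⟩).1) (b i).2 else none
  let P : ∀ i : K, (Set.Iio i → Set V × Option V) → Set V × Option V → Prop := fun i h y =>
    (∀ j, Good (h j)) → Good y ∧ y.2 = tgt i h ∧ ∀ j, (h j).1 ⊆ y.1 ∧ x (h j).1 ∈ y.1 ∧
      ∀ w ∈ Sh (h j), (w ∈ y.1 ↔ gh (h j) w ∈ y.1)
  obtain ⟨f, hf⟩ := exists_recursion P (by
    intro i h
    by_cases hgood : ∀ j, Good (h j)
    swap
    · exact ⟨(∅, none), fun h' => absurd h' hgood⟩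
    have htgt : ∀ v, tgt i h = some v → v ∈ Pop := by
      intro v hv
      by_cases hbi : (b i).1 < i
      · simp only [tgt, dif_pos hbi] at hv
        obtain ⟨h1, h2, -⟩ := hgood ⟨_, hbi⟩
        exact h1.2 ((henum _ (hTlt _ h2)).1 _ _ hv)
      · simp only [tgt, dif_neg hbi] at hv
        exact absurd hv (by simp)
    have hlt1 : ∀ v : V, #({v} : Set V) < κ := fun v => by
      rw [mk_singleton]; exact one_lt_aleph0.trans_le hκ0
    have hA : #(⋃ j, insert (x (h j).1) (h j).1 : Set V) < κ :=
      mk_iUnion_lt hκ (hIio i) fun j => (mk_insert_le).trans_lt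
        (add_lt_of_lt hκ0 (hgood j).2.1 (one_lt_aleph0.trans_le hκ0))
    obtain ⟨N, ⟨hN1, hN2⟩, hN3, hN4⟩ := exists_closed_of_not_clubNull (hnot _ htgt)
      (F := fun e => (⋃ j, insert (x (h j).1) (h j).1) ∪
        ⋃ j, ⋃ v : e, ({gh (h j) v} ∪ {s | s ∈ Sh (h j) ∧ gh (h j) s = v})) (by
        intro e
        refine (mk_union_le _ _).trans_lt (add_lt_of_lt hκ0 hA (mk_iUnion_lt hκ (hIio i)
          fun j => mk_iUnion_lt hκ ((mk_lt_aleph0).trans_le hκ0) fun v => ?_))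
        refine (mk_union_le _ _).trans_lt (add_lt_of_lt hκ0 (hlt1 _) ?_)
        have hss : {s | s ∈ Sh (h j) ∧ gh (h j) s = v}.Subsingleton := fun a ha b hb =>
          (hgh _ (hgood j)).2.1 ha.1 hb.1 (ha.2.trans hb.2.symm)
        refine lt_of_le_of_lt ?_ (one_lt_aleph0.trans_le hκ0)
        rw [Cardinal.le_one_iff_subsingleton]
        exact hss.coe_sort)
    refine ⟨(N, tgt i h), fun _ => ⟨⟨hN1, hN3, hN2⟩, rfl, fun j => ?_⟩⟩
    have hN0 := hN4 ∅ (by simp)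
    have hAN : insert (x (h j).1) (h j).1 ⊆ N := fun z hz =>
      hN0 (Or.inl (Set.mem_iUnion.2 ⟨j, hz⟩))
    refine ⟨(Set.subset_insert _ _).trans hAN, hAN (Set.mem_insert _ _), fun w hw => ⟨?_, ?_⟩⟩
    · intro hwN
      exact hN4 {w} (by simpa using hwN) (Or.inr (Set.mem_iUnion.2 ⟨j, Set.mem_iUnion.2
        ⟨⟨w, by simp⟩, Or.inl rfl⟩⟩))
    · intro hwN
      exact hN4 {gh (h j) w} (by simpa using hwN) (Or.inr (Set.mem_iUnion.2 ⟨j, Set.mem_iUnion.2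
        ⟨⟨gh (h j) w, by simp⟩, Or.inr ⟨hw, rfl⟩⟩⟩)))
  have hgood : ∀ i, Good (f i) := by
    intro i
    induction i using WellFoundedLT.induction with
    | ind i ih => exact (hf i fun j => ih j j.2).1
  have hf2 : ∀ i, (f i).2 = tgt i fun j => f j := fun i => (hf i fun j => hgood j).2.1
  have hf3 : ∀ i j : K, i < j → (f i).1 ⊆ (f j).1 ∧ x (f i).1 ∈ (f j).1 ∧
      ∀ w ∈ Sh (f i), (w ∈ (f j).1 ↔ gh (f i) w ∈ (f j).1) := fun i j hij =>
    (hf j fun j => hgood j).2.2 ⟨i, hij⟩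
  have hKne : Nonempty K := by
    rw [← mk_ne_zero_iff, hK]; exact hκ.pos.ne'
  obtain ⟨i₀, -, hi₀⟩ := (wellFounded_lt (α := K)).has_min Set.univ Set.univ_nonempty
  have ho₀ : (f i₀).2 = none := by
    rw [hf2]
    exact dif_neg (hi₀ _ trivial)
  have hD' := fun i => hD (f i).1 (hgood i).1.1
  refine hΓ (hind_of_tower hr (K := K) (N := fun i => (f i).1) (X := fun i => X (f i).1)
    (o := fun i => (f i).2) (G := fun i => gh (f i)) (i₀ := i₀) (x := x (f i₀).1)
    (fun i => (hD' i).1) (fun i => hgh _ (hgood i)) ?_ ?_ (fun i j hij => (hf3 i j hij).1)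
    (fun i j hij => (hf3 i j hij).2.2) ho₀ (hD' i₀).2.1 ?_ fun j hj => (hf3 i₀ j hj).2.1)
  · intro i v hv
    have := (hgood i).2.2 v hv
    exact ⟨this.1, this.2.1⟩
  · intro i v hvR hvN hu
    obtain ⟨k, hk⟩ := (henum _ (hTlt _ (hgood i).2.1)).2 v ⟨hvR, hvN, hu⟩
    obtain ⟨j, hij, hbj⟩ := hb (i, k) i
    refine ⟨j, ?_⟩
    have hlt : (b j).1 < j := by rw [hbj]; exact hij
    change (f j).2 = some v
    rw [hf2]
    simp only [tgt, dif_pos hlt, hbj]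
    exact hk
  · have : gh (f i₀) = g (f i₀).1 := by simp only [gh, ho₀, Option.elim]
    change _ ∉ gh (f i₀) '' _
    rw [this]
    exact (hD' i₀).2.2.2.1

end Club

section Glue

variable {V : Type u} {r : V → V → Prop} {L R : Set V}

theorem linked_iUnion {ι : Type v} [LinearOrder ι] [WellFoundedLT ι] {B : ι → Set V}
    (hB : ∀ i, Linked r L R (B i)) (hd : ∀ i j z, z ∈ B i → z ∈ B j → i = j) :
    Linked r L R (⋃ i, B i) := by
  choose G hG using hB
  obtain ⟨g, hg, -⟩ := Into.glue hG (fun i j z h1 h2 => ⟨i, le_rfl, h2.1, h1.2⟩)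
    (fun i j w hij hw _ h => hij.ne (hd i j _ h.2 ((hG j).1 w hw).1.2))
  refine ⟨g, ?_⟩
  rwa [Set.inter_iUnion, Set.inter_iUnion]

theorem Linked.union {M N : Set V} (hM : Linked r L R M) (hN : Linked r L R N)
    (hd : Disjoint M N) : Linked r L R (M ∪ N) := by
  rw [Set.union_eq_iUnion]
  refine linked_iUnion (by rintro (_ | _) <;> assumption) ?_
  rintro (_ | _) (_ | _) z h1 h2
  · rfl
  · exact absurd h1 (Set.disjoint_left.1 hd h2)
  · exact absurd h2 (Set.disjoint_left.1 hd h1)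
  · rfl

theorem linked_diff_iff {M N : Set V} :
    Linked r (L \ M) (R \ M) (N \ M) ↔ Linked r L R (N \ M) := by
  have h : ∀ A : Set V, (A \ M) ∩ (N \ M) = A ∩ (N \ M) := fun A => by
    ext z; simp only [Set.mem_inter_iff, Set.mem_sdiff]; tauto
  simp only [Linked, h]

theorem linked_chain {K : Type v} [LinearOrder K] [WellFoundedLT K] {N : K → Set V}
    (h : ∀ i, Linked r (L \ ⋃ j : Set.Iio i, N j) (R \ ⋃ j : Set.Iio i, N j)
      (N i \ ⋃ j : Set.Iio i, N j)) : Linked r L R (⋃ i, N i) := by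
  have hU : ⋃ i, N i = ⋃ i, N i \ ⋃ j : Set.Iio i, N j := by
    refine subset_antisymm ?_ (Set.iUnion_mono fun i => Set.sdiff_subset)
    intro z hz
    obtain ⟨i, hi, hmin⟩ := (wellFounded_lt (α := K)).has_min {i | z ∈ N i} (Set.mem_iUnion.1 hz)
    refine Set.mem_iUnion.2 ⟨i, hi, fun hz' => ?_⟩
    obtain ⟨⟨j, hj⟩, hzj⟩ := Set.mem_iUnion.1 hz'
    exact hmin j hzj hj
  rw [hU]
  refine linked_iUnion (fun i => linked_diff_iff.1 (h i)) ?_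
  have main : ∀ i j z, z ∈ (N i \ ⋃ j : Set.Iio i, N j) → z ∈ (N j \ ⋃ k : Set.Iio j, N k) →
      ¬ i < j := fun i j z h1 h2 hij => h2.2 (Set.mem_iUnion.2 ⟨⟨i, hij⟩, h1.1⟩)
  exact fun i j z h1 h2 => le_antisymm (not_lt.1 (main j i z h2 h1)) (not_lt.1 (main i j z h1 h2))

/-- Every vertex set of size at most `μ` extends to a linked one of the same size whose deletion
preserves unhinderedness. -/
def SafeAt (r : V → V → Prop) (μ : Cardinal.{u}) : Prop :=
  ∀ L R : Set V, ¬ Hind r L R → ∀ Z : Set V, #Z ≤ μ → ∃ N, Z ⊆ N ∧ #N ≤ μ ∧ Linked r L R N ∧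
    ¬ Hind r (L \ N) (R \ N)

end Glue

section Closure

variable {V : Type u} {κ : Cardinal.{u}}

theorem mk_iUnion_finset_lt (hκ : κ.IsRegular) (hκ0 : ℵ₀ < κ) {N : Set V} (hN : #N < κ)
    {C : Finset V → Set V} (hC : ∀ e, #(C e) < κ) :
    #(⋃ e : {e : Finset V // ↑e ⊆ N}, C e : Set V) < κ := by
  classical
  have hcard : #{e : Finset V // ↑e ⊆ N} ≤ #(Finset N) := by
    refine mk_le_of_injective (f := fun e => e.1.subtype (· ∈ N)) ?_
    intro e e' h
    ext z
    have := congrArg (fun s => ∃ hz : z ∈ N, (⟨z, hz⟩ : N) ∈ s) h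
    simp only [Finset.mem_subtype, exists_prop, eq_iff_iff] at this
    exact ⟨fun hz => (this.1 ⟨e.2 hz, hz⟩).2, fun hz => (this.2 ⟨e'.2 hz, hz⟩).2⟩
  refine mk_iUnion_lt hκ (hcard.trans_lt ?_) fun e => hC e
  rcases finite_or_infinite N with h | h
  · exact (mk_lt_aleph0).trans hκ0
  · rwa [mk_finset_of_infinite]

theorem _root_.Monotone.exists_finset_subset {ι : Type v} [LinearOrder ι] [Nonempty ι]
    {s : ι → Set V} (hs : Monotone s) {e : Finset V} (he : ↑e ⊆ ⋃ i, s i) : ∃ i, ↑e ⊆ s i := by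
  classical
  induction e using Finset.induction_on with
  | empty => exact ⟨Classical.arbitrary ι, by simp⟩
  | insert a e _ ih =>
    rw [Finset.coe_insert, Set.insert_subset_iff] at he
    obtain ⟨i, hi⟩ := ih he.2
    obtain ⟨j, hj⟩ := Set.mem_iUnion.1 he.1
    refine ⟨max i j, ?_⟩
    rw [Finset.coe_insert, Set.insert_subset_iff]
    exact ⟨hs (le_max_right i j) hj, hi.trans (hs (le_max_left i j))⟩

theorem exists_closure (hκ : κ.IsRegular) (hκ0 : ℵ₀ < κ) {F : Finset V → Set V}
    (hF : ∀ e, #(F e) < κ) : ∃ cl : Set V → Set V, Monotone cl ∧ (∀ A, A ⊆ cl A) ∧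
      (∀ A, ClosedUnder F (cl A)) ∧ ∀ A : Set V, #A < κ → #(cl A) < κ := by
  classical
  let st : Set V → Set V := fun A => A ∪ ⋃ e : {e : Finset V // ↑e ⊆ A}, F e
  have hst : Monotone st := by
    intro A B hAB
    refine Set.union_subset_union hAB (Set.iUnion_subset fun e => ?_)
    exact Set.subset_iUnion (fun e : {e : Finset V // ↑e ⊆ B} => F e) ⟨e, e.2.trans hAB⟩
  have hsub : ∀ A, A ⊆ st A := fun A => Set.subset_union_left
  have hmono : ∀ A, Monotone fun n => st^[n] A := fun A => monotone_nat_of_le_succ fun n => by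
    rw [Function.iterate_succ_apply']; exact hsub _
  refine ⟨fun A => ⋃ n, st^[n] A, fun A B hAB => Set.iUnion_mono fun n => hst.iterate n hAB,
    fun A => Set.subset_iUnion (fun n => st^[n] A) 0, fun A e he => ?_, fun A hA => ?_⟩
  · obtain ⟨n, hn⟩ := (hmono A).exists_finset_subset he
    refine Set.Subset.trans ?_ (Set.subset_iUnion _ (n + 1))
    rw [Function.iterate_succ_apply']
    exact (Set.subset_iUnion (fun e : {e : Finset V // ↑e ⊆ st^[n] A} => F e) ⟨e, hn⟩).trans
      Set.subset_union_right
  · have hlt : ∀ n, #(st^[n] A) < κ := by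
      intro n
      induction n with
      | zero => exact hA
      | succ n ih =>
        rw [Function.iterate_succ_apply']
        exact (mk_union_le _ _).trans_lt (add_lt_of_lt hκ0.le ih
          (mk_iUnion_finset_lt hκ hκ0 ih hF))
    have := mk_iUnion_lt hκ (ι := ULift.{u} ℕ) (by simpa using hκ0) fun n => hlt n.down
    have h := Equiv.ulift.{u}.surjective.iUnion_comp (fun n : ℕ => st^[n] A)
    change #(⋃ n, st^[n] A : Set V) < κ
    rw [← h]
    exact this

end Closure

section Countable

variable {V : Type u} {r : V → V → Prop} {L R : Set V}

theorem not_hind_diff_diff {M N : Set V} (h : ¬ Hind r ((L \ M) \ N) ((R \ M) \ N)) :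
    ¬ Hind r (L \ (M ∪ N)) (R \ (M ∪ N)) := by
  rwa [Set.sdiff_sdiff, Set.sdiff_sdiff] at h

theorem linked_of_subset (hr : ∀ v, r v v) {N : Set V} (h : L ∩ N ⊆ R) : Linked r L R N :=
  ⟨id, fun w hw => ⟨⟨h hw, hw.2⟩, hr w⟩, Set.injOn_id _, orbFin_id⟩

theorem exists_finite_safe_step (hr : ∀ v, r v v) {Q : Set V} (hQ : Q.Finite)
    (hΓ : ¬ Hind r (L \ Q) (R \ Q)) (o : Option V) : ∃ Q' : Set V, Q ⊆ Q' ∧ Q'.Finite ∧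
      Linked r (L \ Q) (R \ Q) (Q' \ Q) ∧ ¬ Hind r (L \ Q') (R \ Q') ∧
      ∀ a, o = some a → a ∈ L → a ∉ R → a ∈ Q' := by
  by_cases h : ∃ a, o = some a ∧ a ∈ L \ Q ∧ a ∉ R
  · obtain ⟨a, rfl, ha, haR⟩ := h
    obtain ⟨P, h1, h2, h3, h4⟩ := exists_finite_safe hr hΓ ha fun h => haR h.1
    refine ⟨Q ∪ P, Set.subset_union_left, hQ.union h1, ?_, not_hind_diff_diff h4, ?_⟩
    · have h : ∀ A : Set V, (A \ Q) ∩ ((Q ∪ P) \ Q) = (A \ Q) ∩ P := fun A => by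
        ext z; simp only [Set.mem_inter_iff, Set.mem_sdiff, Set.mem_union]; tauto
      simpa only [Linked, h] using h3
    · intro b hb _ _
      exact Or.inr (Option.some.inj hb ▸ h2)
  · refine ⟨Q, subset_rfl, hQ, ?_, hΓ, fun a h1 h2 h3 => ?_⟩
    · rw [Set.sdiff_self]
      exact linked_of_subset hr (by simp)
    · by_contra haQ
      exact h ⟨a, h1, ⟨h2, haQ⟩, h3⟩

theorem safeAt_aleph0 (hr : ∀ v, r v v) : SafeAt r ℵ₀ := by
  intro L R hΓ Z hZ
  have hκ : (Order.succ (ℵ₀ : Cardinal.{u})).IsRegular := isRegular_succ le_rfl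
  have hκ0 : ℵ₀ < Order.succ (ℵ₀ : Cardinal.{u}) := Order.lt_succ _
  obtain ⟨F, hF, hclub⟩ := exists_club hr hκ hΓ
  obtain ⟨cl, hmono, hcl1, hcl2, hcl3⟩ := exists_closure hκ hκ0 hF
  have henum : ∀ A : Set V, ∃ e : ℕ → Option V, #A ≤ ℵ₀ → ∀ v ∈ A, ∃ k, e k = some v := by
    intro A
    by_cases hA : #A ≤ ℵ₀
    · obtain ⟨e, -, he⟩ := exists_enumeration (K := ULift.{u} ℕ) A (by simpa using hA)
      exact ⟨fun n => e ⟨n⟩, fun _ v hv => let ⟨k, hk⟩ := he v hv; ⟨k.down, hk⟩⟩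
    · exact ⟨fun _ => none, fun h => absurd h hA⟩
  choose enum henum using henum
  let tgt : ∀ n : ℕ, (Set.Iio n → Set V) → Option V := fun n h =>
    if hb : n.unpair.1 < n then enum (cl (Z ∪ h ⟨_, hb⟩)) n.unpair.2 else none
  let P : ∀ n : ℕ, (Set.Iio n → Set V) → Set V → Prop := fun n h Q' =>
    (⋃ j, h j).Finite → ¬ Hind r (L \ ⋃ j, h j) (R \ ⋃ j, h j) →
      ⋃ j, h j ⊆ Q' ∧ Q'.Finite ∧ Linked r (L \ ⋃ j, h j) (R \ ⋃ j, h j) (Q' \ ⋃ j, h j) ∧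
      ¬ Hind r (L \ Q') (R \ Q') ∧ ∀ a, tgt n h = some a → a ∈ L → a ∉ R → a ∈ Q'
  obtain ⟨Q, hQ⟩ := exists_recursion P (by
    intro n h
    by_cases h1 : (⋃ j, h j).Finite ∧ ¬ Hind r (L \ ⋃ j, h j) (R \ ⋃ j, h j)
    · obtain ⟨Q', hQ'⟩ := exists_finite_safe_step hr h1.1 h1.2 (tgt n h)
      exact ⟨Q', fun _ _ => hQ'⟩
    · exact ⟨∅, fun h2 h3 => absurd ⟨h2, h3⟩ h1⟩)
  have hgood : ∀ n : ℕ, (⋃ j : Set.Iio n, Q j).Finite ∧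
      ¬ Hind r (L \ ⋃ j : Set.Iio n, Q j) (R \ ⋃ j : Set.Iio n, Q j) := by
    intro n
    induction n with
    | zero =>
      have : ⋃ j : Set.Iio 0, Q j = ∅ := by simp
      rw [this]
      simpa using hΓ
    | succ n ih =>
      obtain ⟨h1, h2, -, h4, -⟩ := hQ n ih.1 ih.2
      have : ⋃ j : Set.Iio (n + 1), Q j = Q n := by
        refine subset_antisymm (Set.iUnion_subset ?_)
          (Set.subset_iUnion (fun j : Set.Iio (n + 1) => Q j) ⟨n, Nat.lt_succ_self n⟩)
        rintro ⟨j, hj⟩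
        rcases (Nat.lt_succ_iff.1 hj).lt_or_eq with h | rfl
        · exact (Set.subset_iUnion (fun j : Set.Iio n => Q j) ⟨j, h⟩).trans h1
        · exact subset_rfl
      rw [this]
      exact ⟨h2, h4⟩
  have hQ' := fun n => hQ n (hgood n).1 (hgood n).2
  have hQmono : Monotone Q := by
    intro m n hmn
    rcases hmn.lt_or_eq with h | rfl
    · exact (Set.subset_iUnion (fun j : Set.Iio n => Q j) ⟨m, h⟩).trans (hQ' n).1
    · exact subset_rfl
  have hclmono : Monotone fun n => cl (Z ∪ Q n) := fun m n hmn =>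
    hmono (Set.union_subset_union_right _ (hQmono hmn))
  have hclcard : ∀ n, #(cl (Z ∪ Q n)) ≤ ℵ₀ := fun n => Order.lt_succ_iff.1 <| hcl3 _ <|
    Order.lt_succ_iff.2 <| (mk_union_le _ _).trans <|
      add_le_aleph0.2 ⟨hZ, (hQ' n).2.1.countable.le_aleph0⟩
  have hNcard : #(⋃ n, cl (Z ∪ Q n) : Set V) ≤ ℵ₀ :=
    Set.Countable.le_aleph0 (Set.countable_iUnion fun n =>
      le_aleph0_iff_set_countable.1 (hclcard n))
  have hQN : ⋃ n, Q n ⊆ ⋃ n, cl (Z ∪ Q n) := Set.iUnion_mono fun n =>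
    Set.subset_union_right.trans (hcl1 _)
  refine ⟨⋃ n, cl (Z ∪ Q n), ?_, hNcard, ?_, hclub _ (Order.lt_succ_iff.2 hNcard) ?_⟩
  · exact (Set.subset_union_left.trans (hcl1 _)).trans (Set.subset_iUnion (fun n => cl (Z ∪ Q n)) 0)
  · rw [← Set.union_sdiff_cancel hQN]
    refine Linked.union (linked_chain fun n => (hQ' n).2.2.1) (linked_of_subset hr ?_)
      Set.disjoint_sdiff_right
    rintro a ⟨haL, haN, haQ⟩
    by_contra haR
    obtain ⟨k, hk⟩ := Set.mem_iUnion.1 haN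
    obtain ⟨m, hm⟩ := henum _ (hclcard (k + 1)) a (hclmono (Nat.le_succ k) hk)
    have hlt : k + 1 < Nat.pair (k + 1) m := by
      rw [Nat.pair]
      split_ifs <;> nlinarith
    refine haQ (Set.mem_iUnion.2 ⟨Nat.pair (k + 1) m, (hQ' _).2.2.2.2 a ?_ haL haR⟩)
    simp only [tgt, Nat.unpair_pair, dif_pos hlt, hm]
  · intro e he
    obtain ⟨n, hn⟩ := hclmono.exists_finset_subset he
    exact (hcl2 _ e hn).trans (Set.subset_iUnion (fun n => cl (Z ∪ Q n)) n)

end Countable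

section Chain

variable {V : Type u} {r : V → V → Prop} {L R : Set V}

theorem exists_safe_step {κ : Cardinal.{u}} (hκ : κ.IsRegular) (hκ0 : ℵ₀ < κ)
    (hsafe : ∀ ν < κ, ℵ₀ ≤ ν → SafeAt r ν) {C : Finset V → Set V} (hC : ∀ e, #(C e) < κ)
    {M : Set V} (hM : #M < κ) (hΓ : ¬ Hind r (L \ M) (R \ M)) :
    ∃ N : Set V, M ⊆ N ∧ (∀ e : Finset V, ↑e ⊆ M → C e ⊆ N) ∧ #N < κ ∧
      Linked r (L \ M) (R \ M) (N \ M) ∧ ¬ Hind r (L \ N) (R \ N) := by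
  have hreq := mk_iUnion_finset_lt hκ hκ0 hM hC
  obtain ⟨P, hP1, hP2, hP3, hP4⟩ := hsafe _ (max_lt hκ0 hreq) (le_max_left _ _) _ _ hΓ _
    (le_max_right _ _)
  refine ⟨M ∪ P, Set.subset_union_left, fun e he => ?_, ?_, ?_, not_hind_diff_diff hP4⟩
  · exact ((Set.subset_iUnion (fun e : {e : Finset V // ↑e ⊆ M} => C e) ⟨e, he⟩).trans
      hP1).trans Set.subset_union_right
  · exact (mk_union_le _ _).trans_lt (add_lt_of_lt hκ0.le hM (hP2.trans_lt (max_lt hκ0 hreq)))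
  · have h : ∀ A : Set V, (A \ M) ∩ ((M ∪ P) \ M) = (A \ M) ∩ P := fun A => by
      ext z; simp only [Set.mem_inter_iff, Set.mem_sdiff, Set.mem_union]; tauto
    simpa only [Linked, h] using hP3

/-- A chain of small sets, each absorbing the requests `C` of the finite subsets of its
predecessor, yields a linked set whose deletion preserves unhinderedness. -/
theorem exists_safe_of_chain (hΓ : ¬ Hind r L R) {μ : Cardinal.{u}}
    (hsafe : ∀ ν < μ, ℵ₀ ≤ ν → SafeAt r ν) {K : Type u} [LinearOrder K] [WellFoundedLT K]
    [NoMaxOrder K] [Nonempty K] (hK : #K ≤ μ) {κ : K → Cardinal.{u}}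
    (hκ : ∀ i, (κ i).IsRegular) (hκ0 : ∀ i, ℵ₀ < κ i) (hκμ : ∀ i, κ i ≤ μ) (hκmono : Monotone κ)
    (hIio : ∀ i, #(Set.Iio i) < κ i) {F : K → Finset V → Set V}
    (hF : ∀ i (N : Set V), #N < κ i → ClosedUnder (F i) N → ¬ Hind r (L \ N) (R \ N))
    {F' : Finset V → Set V}
    (hF' : ∀ N : Set V, #N ≤ μ → ClosedUnder F' N → ¬ Hind r (L \ N) (R \ N)) {Z : Set V}
    {C : K → Finset V → Set V} (hC : ∀ e, Monotone fun i => C i e) (hCκ : ∀ i e, #(C i e) < κ i)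
    (hCF : ∀ i, (∀ j < i, ∃ k, j < k ∧ k < i) → ∀ j < i, ∀ e, F i e ⊆ ⋃ k : Set.Iio i, C k e)
    (hCF' : ∀ e, F' e ∪ Z ⊆ ⋃ k, C k e) :
    ∃ N, Z ⊆ N ∧ #N ≤ μ ∧ Linked r L R N ∧ ¬ Hind r (L \ N) (R \ N) := by
  have hμ0 : ℵ₀ ≤ μ := (hκ0 (Classical.arbitrary K)).le.trans (hκμ _)
  let P : ∀ i : K, (Set.Iio i → Set V) → Set V → Prop := fun i h N =>
    #(⋃ j, h j : Set V) < κ i → ¬ Hind r (L \ ⋃ j, h j) (R \ ⋃ j, h j) →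
      ⋃ j, h j ⊆ N ∧ (∀ e : Finset V, ↑e ⊆ ⋃ j, h j → C i e ⊆ N) ∧ #N < κ i ∧
      Linked r (L \ ⋃ j, h j) (R \ ⋃ j, h j) (N \ ⋃ j, h j) ∧ ¬ Hind r (L \ N) (R \ N)
  obtain ⟨N, hN⟩ := exists_recursion P fun i h => by
    by_cases h1 : #(⋃ j, h j : Set V) < κ i ∧ ¬ Hind r (L \ ⋃ j, h j) (R \ ⋃ j, h j)
    · obtain ⟨N, hN⟩ := exists_safe_step (hκ i) (hκ0 i)
        (fun ν hν => hsafe ν (hν.trans_le (hκμ i))) (hCκ i) h1.1 h1.2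
      exact ⟨N, fun _ _ => hN⟩
    · exact ⟨∅, fun h2 h3 => absurd ⟨h2, h3⟩ h1⟩
  have hgood : ∀ i, #(⋃ j : Set.Iio i, N j : Set V) < κ i ∧
      ¬ Hind r (L \ ⋃ j : Set.Iio i, N j) (R \ ⋃ j : Set.Iio i, N j) := by
    intro i
    induction i using WellFoundedLT.induction with
    | ind i ih =>
    have hN' := fun (j : K) (hj : j < i) => hN j (ih j hj).1 (ih j hj).2
    have hmono : ∀ j k : K, j ≤ k → k < i → N j ⊆ N k := by
      intro j k hjk hk
      rcases hjk.lt_or_eq with h | rfl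
      · exact (Set.subset_iUnion (fun j : Set.Iio k => N j) ⟨j, h⟩).trans (hN' k hk).1
      · exact subset_rfl
    have hlt : #(⋃ j : Set.Iio i, N j : Set V) < κ i :=
      mk_iUnion_lt (hκ i) (hIio i) fun j => (hN' j j.2).2.2.1.trans_le (hκmono (le_of_lt j.2))
    refine ⟨hlt, ?_⟩
    by_cases hmax : ∃ j < i, ∀ k < i, k ≤ j
    · obtain ⟨j, hj, hjmax⟩ := hmax
      have : ⋃ j : Set.Iio i, N j = N j := subset_antisymm
        (Set.iUnion_subset fun k => hmono k j (hjmax k k.2) hj)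
        (Set.subset_iUnion (fun j : Set.Iio i => N j) ⟨j, hj⟩)
      rw [this]
      exact (hN' j hj).2.2.2.2
    push Not at hmax
    by_cases hbot : ∃ j, j < i
    · obtain ⟨j₀, hj₀⟩ := hbot
      refine hF i _ hlt fun e he x hx => ?_
      have : Nonempty (Set.Iio i) := ⟨⟨j₀, hj₀⟩⟩
      obtain ⟨j, hj⟩ := Monotone.exists_finset_subset (s := fun j : Set.Iio i => N j)
        (fun j k hjk => hmono j k hjk k.2) he
      obtain ⟨k, hk⟩ := Set.mem_iUnion.1
        (hCF i (fun j hj => (hmax j hj).imp fun k hk => hk.symm) j₀ hj₀ e hx)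
      obtain ⟨l, hli, hl⟩ := hmax (max j k) (max_lt j.2 k.2)
      refine Set.mem_iUnion.2 ⟨⟨l, hli⟩, (hN' l hli).2.1 e ?_ (hC e ?_ hk)⟩
      · exact hj.trans (Set.subset_iUnion (fun m : Set.Iio l => N m)
          ⟨j, (le_max_left _ _).trans_lt hl⟩)
      · exact (le_max_right _ _).trans hl.le
    · have : ⋃ j : Set.Iio i, N j = ∅ := Set.iUnion_eq_empty.2 fun j => absurd ⟨j.1, j.2⟩ hbot
      rw [this]
      simpa using hΓ
  have hN' := fun i => hN i (hgood i).1 (hgood i).2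
  have hmono : Monotone N := by
    intro j k hjk
    rcases hjk.lt_or_eq with h | rfl
    · exact (Set.subset_iUnion (fun j : Set.Iio k => N j) ⟨j, h⟩).trans (hN' k).1
    · exact subset_rfl
  have hcl : ∀ e : Finset V, ↑e ⊆ ⋃ i, N i → F' e ∪ Z ⊆ ⋃ i, N i := by
    intro e he x hx
    obtain ⟨j, hj⟩ := hmono.exists_finset_subset he
    obtain ⟨k, hk⟩ := Set.mem_iUnion.1 (hCF' e hx)
    obtain ⟨l, hl⟩ := exists_gt (max j k)
    refine Set.mem_iUnion.2 ⟨l, (hN' l).2.1 e ?_ (hC e ((le_max_right _ _).trans hl.le) hk)⟩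
    exact hj.trans (Set.subset_iUnion (fun m : Set.Iio l => N m)
      ⟨j, (le_max_left _ _).trans_lt hl⟩)
  have hcard : #(⋃ i, N i : Set V) ≤ μ := by
    refine (mk_iUnion_le _).trans ?_
    refine (mul_le_mul' hK (ciSup_le' fun i => ((hN' i).2.2.1.le.trans (hκμ i)))).trans ?_
    rw [mul_eq_self hμ0]
  refine ⟨⋃ i, N i, Set.subset_union_right.trans (hcl ∅ (by simp)), hcard,
    linked_chain fun i => (hN' i).2.2.2.1,
    hF' _ hcard fun e he => Set.subset_union_left.trans (hcl e he)⟩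

end Chain

section Instances

variable {V : Type u} {r : V → V → Prop} {L R : Set V} {μ : Cardinal.{u}}

theorem safeAt_of_isRegular (hr : ∀ v, r v v) (hμ : μ.IsRegular) (hμ0 : ℵ₀ < μ)
    (hsafe : ∀ ν < μ, ℵ₀ ≤ ν → SafeAt r ν) : SafeAt r μ := by
  intro L R hΓ Z hZ
  obtain ⟨F, hF, hclub⟩ := exists_club hr hμ hΓ
  obtain ⟨F', hF', hclub'⟩ := exists_club hr (isRegular_succ hμ0.le) hΓ
  have hK : #μ.ord.ToType = μ := mk_ord_toType μ
  have hIio : ∀ i : μ.ord.ToType, #(Set.Iio i) < μ := mk_Iio_ord_toType_lt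
  have : Nonempty μ.ord.ToType := by rw [← mk_ne_zero_iff, hK]; exact hμ.pos.ne'
  have : NoMaxOrder μ.ord.ToType := noMaxOrder hμ0.le
  have hB : ∀ e, #(F' e ∪ Z : Set V) ≤ #μ.ord.ToType := fun e => by
    rw [hK]
    exact (mk_union_le _ _).trans (add_le_of_le hμ0.le (Order.lt_succ_iff.1 (hF' e)) hZ)
  have hρ : ∀ e, ∃ ρ : (F' e ∪ Z : Set V) → μ.ord.ToType, Function.Injective ρ := fun e =>
    let ⟨ρ⟩ := hB e
    ⟨ρ, ρ.injective⟩
  choose ρ hρ using hρ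
  refine exists_safe_of_chain hΓ hsafe hK.le (κ := fun _ => μ) (fun _ => hμ) (fun _ => hμ0)
    (fun _ => le_rfl) (fun _ _ _ => le_rfl) hIio (F := fun _ => F) (fun _ => hclub)
    (F' := F') (fun N hN => hclub' N (Order.lt_succ_iff.2 hN))
    (C := fun i e => F e ∪ Subtype.val '' {x | ρ e x < i}) ?_ ?_ ?_ ?_
  · exact fun e i j hij => Set.union_subset_union_right _
      (Set.image_mono fun x hx => lt_of_lt_of_le hx hij)
  · refine fun i e => (mk_union_le _ _).trans_lt (add_lt_of_lt hμ0.le (hF e) ?_)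
    refine (mk_image_le).trans_lt (lt_of_le_of_lt ?_ (hIio i))
    exact mk_le_of_injective (f := fun x => (⟨ρ e x.1, x.2⟩ : Set.Iio i)) fun x y h =>
      Subtype.ext (hρ e (congrArg Subtype.val h))
  · exact fun i _ j hj e x hx => Set.mem_iUnion.2 ⟨⟨j, hj⟩, Or.inl hx⟩
  · intro e x hx
    obtain ⟨i, hi⟩ := exists_gt (ρ e ⟨x, hx⟩)
    exact Set.mem_iUnion.2 ⟨i, Or.inr ⟨⟨x, hx⟩, hi, rfl⟩⟩

theorem exists_cardinal_rank (A : Set V) : ∃ d : V → Cardinal.{u}, (∀ x ∈ A, d x < #A) ∧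
    ∀ c, #{x | x ∈ A ∧ d x < c} ≤ c := by
  classical
  obtain ⟨e⟩ : Nonempty (A ≃ (#A).ord.ToType) := by rw [← Cardinal.eq, mk_ord_toType]
  let ρ : A → Ordinal.{u} := fun x => Ordinal.typein LT.lt (e x)
  have hρ : Function.Injective ρ := fun x y h => e.injective (Ordinal.typein_injective LT.lt h)
  refine ⟨fun x => if h : x ∈ A then (ρ ⟨x, h⟩).card else 0, fun x hx => ?_, fun c => ?_⟩
  · simp only [dif_pos hx]
    exact lt_ord.1 ((Ordinal.typein_lt_type LT.lt _).trans_eq (Ordinal.type_toType _))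
  · have h := mk_le_of_injective (α := ULift.{u + 1} {x | x ∈ A ∧
      (if h : x ∈ A then (ρ ⟨x, h⟩).card else 0) < c}) (β := Set.Iio c.ord)
      (f := fun x => ⟨ρ ⟨x.down.1, x.down.2.1⟩, lt_ord.2 (by
        have := x.down.2.2
        rwa [dif_pos x.down.2.1] at this)⟩) fun x y h => by
        have h' : x.down.1 = y.down.1 :=
          congrArg (fun a : A => (a : V)) (hρ (congrArg Subtype.val h))
        exact ULift.down_injective (Subtype.ext h')
    rwa [mk_Iio_ordinal, card_ord, mk_uLift, lift_le] at h

theorem safeAt_of_not_isRegular (hr : ∀ v, r v v) (hμ : ¬ μ.IsRegular) (hμ0 : ℵ₀ ≤ μ)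
    (hsafe : ∀ ν < μ, ℵ₀ ≤ ν → SafeAt r ν) : SafeAt r μ := by
  intro L R hΓ Z hZ
  have hne : Nonempty μ.ord.ToType := by
    rw [← mk_ne_zero_iff, mk_ord_toType]; exact (aleph0_pos.trans_le hμ0).ne'
  have : NoMaxOrder μ.ord.ToType := noMaxOrder hμ0
  obtain ⟨K, hKcof, hK⟩ := Order.exists_cof_eq μ.ord.ToType
  rw [Ordinal.cof_toType] at hK
  have hcof : μ.ord.cof < μ := not_le.1 fun h => hμ ⟨hμ0, h⟩
  have hcof0 : ℵ₀ ≤ μ.ord.cof := by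
    rw [← Ordinal.cof_toType]; exact Order.aleph0_le_cof
  have hsucc : ∀ ν < μ, Order.succ ν < μ := by
    intro ν hν
    refine lt_of_le_of_ne (Order.succ_le_of_lt hν) fun h => hμ ?_
    rw [← h]
    refine isRegular_succ (not_lt.1 fun hlt => ?_)
    exact absurd (h ▸ hμ0) (not_le.2 (isSuccLimit_aleph0.succ_lt hlt))
  have hKgt : ∀ x : μ.ord.ToType, ∃ i : K, x < i := by
    intro x
    obtain ⟨y, hy⟩ := exists_gt x
    obtain ⟨z, hz, hyz⟩ := hKcof y
    exact ⟨⟨z, hz⟩, hy.trans_le hyz⟩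
  have : Nonempty K := let ⟨i, _⟩ := hKgt hne.some; ⟨i⟩
  have : NoMaxOrder K := ⟨fun i => let ⟨j, hj⟩ := hKgt i; ⟨j, hj⟩⟩
  let c : K → Cardinal.{u} := fun i => #(Set.Iio (i : μ.ord.ToType))
  have hc : ∀ i, c i < μ := fun i => mk_Iio_ord_toType_lt _
  have hcgt : ∀ ν < μ, ∃ i, ν < c i := by
    intro ν hν
    have hlt : (Order.succ ν).ord < Ordinal.type (α := μ.ord.ToType) LT.lt := by
      rw [Ordinal.type_toType]
      exact ord_lt_ord.2 (hsucc ν hν)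
    obtain ⟨i, hi⟩ := hKgt (Ordinal.enum (α := μ.ord.ToType) LT.lt ⟨_, hlt⟩)
    refine ⟨i, (Order.lt_succ ν).trans_le (le_trans (le_of_eq ?_)
      (mk_le_mk_of_subset (Set.Iio_subset_Iio hi.le)))⟩
    have h := Ordinal.card_typein (r := LT.lt) (Ordinal.enum (α := μ.ord.ToType) LT.lt ⟨_, hlt⟩)
    rw [Ordinal.typein_enum, card_ord] at h
    exact h
  let ℓ : K → Cardinal.{u} := fun i => max μ.ord.cof (⨆ j : Set.Iio i, c j)
  have hbdd : ∀ i : K, BddAbove (Set.range fun j : Set.Iio i => c j) := fun i => bddAbove_of_small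
  have hℓμ : ∀ i, ℓ i < μ := by
    intro i
    exact max_lt hcof ((ciSup_le' fun j => mk_le_mk_of_subset
      (Set.Iio_subset_Iio (le_of_lt j.2))).trans_lt (hc i))
  have hcℓ : ∀ i j, i < j → c i ≤ ℓ j := fun i j hij =>
    (le_ciSup (hbdd j) ⟨i, hij⟩).trans (le_max_right _ _)
  have hℓmono : Monotone ℓ := by
    intro i j hij
    refine max_le_max le_rfl (ciSup_le' fun k => le_ciSup (hbdd j) ⟨k.1, k.2.trans_le hij⟩)
  have hℓlim : ∀ i, (∀ j < i, ∃ k, j < k ∧ k < i) → (∃ j, j < i) → ∀ ν < ℓ i, ∃ j < i, ν < ℓ j := by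
    intro i hi ⟨j₀, hj₀⟩ ν hν
    rcases lt_max_iff.1 hν with h | h
    · exact ⟨j₀, hj₀, lt_max_iff.2 (Or.inl h)⟩
    · obtain ⟨j, hj⟩ := exists_lt_of_lt_ciSup' h
      obtain ⟨k, hjk, hk⟩ := hi j j.2
      exact ⟨k, hk, hj.trans_le (hcℓ j k hjk)⟩
  have hℓ0 : ∀ i, ℵ₀ ≤ ℓ i := fun i => hcof0.trans (le_max_left _ _)
  have hreg : ∀ i, (Order.succ (ℓ i)).IsRegular := fun i => isRegular_succ (hℓ0 i)
  have hκ0 : ∀ i, ℵ₀ < Order.succ (ℓ i) := fun i => (hℓ0 i).trans_lt (Order.lt_succ _)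
  have hKlt : ∀ i, #K < Order.succ (ℓ i) := fun i =>
    Order.lt_succ_iff.2 (hK.le.trans (le_max_left _ _))
  choose F hF hclub using fun i => exists_club hr (hreg i) hΓ
  obtain ⟨F', hF', hclub'⟩ := exists_club hr (isRegular_succ hμ0) hΓ
  have hB : ∀ e, #(F' e ∪ Z : Set V) ≤ μ := fun e =>
    (mk_union_le _ _).trans (add_le_of_le hμ0 (Order.lt_succ_iff.1 (hF' e)) hZ)
  choose d hd hdc using exists_cardinal_rank (V := V)
  refine exists_safe_of_chain hΓ hsafe (hK.trans_lt hcof).le (κ := fun i => Order.succ (ℓ i)) hreg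
    hκ0 (fun i => (hsucc _ (hℓμ i)).le) (fun i j hij => Order.succ_le_succ (hℓmono hij))
    (fun i => (mk_set_le _).trans_lt (hKlt i)) hclub
    (F' := F') (fun N hN => hclub' N (Order.lt_succ_iff.2 hN))
    (C := fun i e => (⋃ k, {x | x ∈ F k e ∧ d (F k e) x < ℓ i}) ∪
      {x | x ∈ F' e ∪ Z ∧ d (F' e ∪ Z) x < ℓ i}) ?_ ?_ ?_ ?_
  · intro e i j hij
    exact Set.union_subset_union
      (Set.iUnion_mono fun k x hx => ⟨hx.1, hx.2.trans_le (hℓmono hij)⟩)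
      fun x hx => ⟨hx.1, hx.2.trans_le (hℓmono hij)⟩
  · intro i e
    refine (mk_union_le _ _).trans_lt (add_lt_of_lt (hκ0 i).le ?_ ?_)
    · exact mk_iUnion_lt (hreg i) (hKlt i) fun k => Order.lt_succ_iff.2 (hdc _ _)
    · exact Order.lt_succ_iff.2 (hdc _ _)
  · intro i hi j hj e x hx
    obtain ⟨k, hk, hk'⟩ := hℓlim i hi ⟨j, hj⟩ _
      ((hd _ x hx).trans_le (Order.lt_succ_iff.1 (hF i e)))
    exact Set.mem_iUnion.2 ⟨⟨k, hk⟩, Or.inl (Set.mem_iUnion.2 ⟨i, hx, hk'⟩)⟩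
  · intro e x hx
    obtain ⟨i, hi⟩ := hcgt _ ((hd _ x hx).trans_le (hB e))
    obtain ⟨j, hj⟩ := exists_gt i
    exact Set.mem_iUnion.2 ⟨j, Or.inr ⟨hx, hi.trans_le (hcℓ i j hj)⟩⟩

theorem safeAt (hr : ∀ v, r v v) (hμ : ℵ₀ ≤ μ) : SafeAt r μ := by
  induction μ using WellFoundedLT.induction with
  | ind μ ih =>
  rcases hμ.eq_or_lt with rfl | hμ0
  · exact safeAt_aleph0 hr
  · by_cases h : μ.IsRegular
    · exact safeAt_of_isRegular hr h hμ0 fun ν h1 h2 => ih ν h1 h2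
    · exact safeAt_of_not_isRegular hr h hμ fun ν h1 h2 => ih ν h1 h2

/-- Unhindered webs are linkable. -/
theorem linked_univ_of_not_hind (hr : ∀ v, r v v) (hΓ : ¬ Hind r L R) :
    Linked r L R Set.univ := by
  obtain ⟨N, h1, -, h2, -⟩ := safeAt hr (le_max_left ℵ₀ #V) L R hΓ Set.univ
    (mk_univ.le.trans (le_max_right _ _))
  rwa [Set.univ_subset_iff.1 h1] at h2

end Instances

section Orbits

variable {V : Type u} {r : V → V → Prop} {S Y : Set V} {g : V → V} {c d : V}

theorem iterate_eq_or_mem (hg : Into r S Y g) (hid : ∀ w ∉ S, g w = w) (n : ℕ) :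
    g^[n] c = c ∨ g^[n] c ∈ Y := by
  induction n with
  | zero => exact Or.inl rfl
  | succ n ih =>
    rw [Function.iterate_succ_apply']
    by_cases h : g^[n] c ∈ S
    · exact Or.inr (hg.1 _ h).1
    · rwa [hid _ h]

theorem eq_of_iterate_eq_iterate (hg : Into r S Y g) (hid : ∀ w ∉ S, g w = w) (hc : c ∉ Y)
    (hd : d ∉ Y) {n m : ℕ} (h : g^[n] c = g^[m] d) : c = d := by
  induction hk : n + m using Nat.strong_induction_on generalizing n m with
  | _ k ih =>
    rcases n with _ | n
    · rcases iterate_eq_or_mem (c := d) hg hid m with h' | h'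
      · exact h.trans h'
      · exact absurd (h.symm ▸ h' : g^[0] c ∈ Y) hc
    rcases m with _ | m
    · rcases iterate_eq_or_mem (c := c) hg hid (n + 1) with h' | h'
      · exact h'.symm.trans h
      · exact absurd (h ▸ h' : g^[0] d ∈ Y) hd
    by_cases h1 : g^[n] c ∈ S
    · by_cases h2 : g^[m] d ∈ S
      · rw [Function.iterate_succ_apply', Function.iterate_succ_apply'] at h
        exact ih (n + m) (by omega) (hg.2.1 h1 h2 h) rfl
      · refine ih (n + 1 + m) (by omega) ?_ rfl
        rw [h, Function.iterate_succ_apply', hid _ h2]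
    · refine ih (n + (m + 1)) (by omega) ?_ rfl
      rw [← h, Function.iterate_succ_apply', hid _ h1]

theorem exists_iterate_notMem (hg : Into r S Y g) (hc : c ∉ Y) : ∃ n, g^[n] c ∉ S := by
  by_contra! h
  have hinj : Function.Injective fun n : ℕ => g^[n] c := by
    have key : ∀ n k : ℕ, g^[n] c ≠ g^[n + (k + 1)] c := by
      intro n k
      induction n with
      | zero =>
        intro h'
        rw [Nat.zero_add, Function.iterate_succ_apply'] at h'
        exact hc (h'.symm ▸ (hg.1 _ (h k)).1 : g^[0] c ∈ Y)
      | succ n ih =>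
        intro h'
        rw [Nat.add_right_comm, Function.iterate_succ_apply', Function.iterate_succ_apply'] at h'
        exact ih (hg.2.1 (h _) (h _) h')
    intro n m hnm
    rcases lt_trichotomy n m with h' | h' | h'
    · obtain ⟨k, rfl⟩ := Nat.exists_eq_add_of_lt h'
      exact absurd hnm (key n k)
    · exact h'
    · obtain ⟨k, rfl⟩ := Nat.exists_eq_add_of_lt h'
      exact absurd hnm.symm (key m k)
  exact Set.infinite_range_of_injective hinj (hg.2.2 c)

theorem reflTransGen_iterate {q : V → V → Prop} {P : Set V} (hP : ∀ n, g^[n] c ∈ P)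
    (hg : ∀ w, g w = w ∨ q w (g w)) (n : ℕ) :
    Relation.ReflTransGen (fun a b => a ∈ P ∧ b ∈ P ∧ q a b) c (g^[n] c) := by
  induction n with
  | zero => exact .refl
  | succ n ih =>
    have h1 := hP (n + 1)
    rw [Function.iterate_succ_apply'] at h1 ⊢
    rcases hg (g^[n] c) with h | h
    · rwa [h]
    · exact ih.tail ⟨hP n, h1, h⟩

end Orbits
end WebLinkage

namespace MultiDigraph

variable {V E : Type*} {D : MultiDigraph V E} {L : Set E} {s t : V}

theorem isPathIn_singleton {e : E} (he : e ∈ L) : D.IsPathIn L (D.tail e) (D.head e) [e] :=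
  ⟨by simp, rfl, rfl, List.isChain_singleton _, by simpa using D.no_loops e, by simpa using he⟩

/-- A walk between distinct vertices contains a path. -/
theorem exists_isPathIn_of_reflTransGen {a b : E} (hb : b ∈ L)
    (h : Relation.ReflTransGen (fun e f => e ∈ L ∧ f ∈ L ∧ D.head e = D.tail f) a b)
    (hab : D.tail a ≠ D.head b) : ∃ p, D.IsPathIn L (D.tail a) (D.head b) p := by
  induction h using Relation.ReflTransGen.head_induction_on with
  | refl => exact ⟨[b], isPathIn_singleton hb⟩
  | @head e f hef _ ih =>
    obtain ⟨he, hf, hef⟩ := hef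
    by_cases hfb : D.tail f = D.head b
    · rw [← hfb, ← hef]
      exact ⟨[e], isPathIn_singleton he⟩
    obtain ⟨p, hne, h1, h2, h3, h4, h5⟩ := ih hfb
    by_cases hmem : D.tail e ∈ D.tail f :: p.map D.head
    · rcases List.mem_cons.1 hmem with h | h
      · exact absurd (h.trans hef.symm) (D.no_loops e)
      · obtain ⟨d, hd, hde⟩ := List.mem_map.1 h
        obtain ⟨p₁, p₂, rfl⟩ := List.append_of_mem hd
        have hp₂ : p₂ ≠ [] := by
          rintro rfl
          rw [List.getLast_append_of_ne_nil _ (List.cons_ne_nil d []), List.getLast_singleton] at h2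
          exact hab (hde.symm.trans h2)
        have h3' := (List.isChain_append.1 h3).2.1
        refine ⟨p₂, hp₂, ?_, ?_, (List.isChain_cons.1 h3').2, ?_, fun x hx => h5 x (by simp [hx])⟩
        · rw [← hde]
          exact ((List.isChain_cons.1 h3').1 _ (List.head?_eq_some_head hp₂)).symm
        · rw [← h2, List.getLast_append_of_ne_nil _ (List.cons_ne_nil d p₂),
            List.getLast_cons hp₂]
        · rw [← hde, ← List.map_cons]
          refine h4.sublist (List.Sublist.cons _ (List.Sublist.map _ ?_))
          exact List.sublist_append_right _ _
    · refine ⟨e :: p, by simp, rfl, ?_, ?_, ?_, ?_⟩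
      · rw [List.getLast_cons hne, h2]
      · refine List.isChain_cons.2 ⟨fun y hy => ?_, h3⟩
        rw [List.head?_eq_some_head hne, Option.mem_some_iff] at hy
        rw [← hy, h1, hef]
      · rw [List.map_cons, hef]
        rw [List.nodup_cons]
        exact ⟨hmem, h4⟩
      · intro x hx
        rcases List.mem_cons.1 hx with rfl | hx
        · exact he
        · exact h5 x hx

theorem IsPathIn.mono {L' : Set E} {p : List E} (h : D.IsPathIn L s t p) (hL : L ⊆ L') :
    D.IsPathIn L' s t p :=
  let ⟨h0, h1, h2, h3, h4, h5⟩ := h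
  ⟨h0, h1, h2, h3, h4, fun e he => hL (h5 e he)⟩

/-- A set of edges is a cut if the edges before it form a set which is closed under successors. -/
theorem isCut_of_closed {C X : Set E} (hs : ∀ e, D.tail e = s → e ∈ X ∪ C)
    (hX : ∀ e ∈ X, ∀ f, D.head e = D.tail f → f ∈ X ∪ C) (ht : ∀ e ∈ X, D.head e ≠ t) :
    D.IsCut L s t C := by
  rintro p ⟨hne, h1, h2, h3, -, -⟩
  by_contra! hC
  suffices h : ∀ q : List E, ∀ hq : q ≠ [], q.IsChain (fun e f => D.head e = D.tail f) →
      (∀ e ∈ q, e ∉ C) → q.head hq ∈ X → q.getLast hq ∈ X from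
    ht _ (h p hne h3 hC ((hs _ h1).resolve_right (hC _ (List.head_mem hne)))) h2
  intro q
  induction q with
  | nil => exact fun hq => absurd rfl hq
  | cons e q ih =>
    intro _ hch hqC he
    rcases q with _ | ⟨f, q⟩
    · exact he
    · rw [List.isChain_cons_cons] at hch
      rw [List.getLast_cons (List.cons_ne_nil f q)]
      exact ih (List.cons_ne_nil f q) hch.2 (fun x hx => hqC x (List.mem_cons_of_mem _ hx))
        ((hX e he f hch.1).resolve_right (hqC f (by simp)))

end MultiDigraph

open WebLinkage in
/-- **Aharoni–Berger, edge version of the infinite Menger theorem.**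
In any (possibly infinite) digraph with distinct vertices `s, t`, there is a set `Ps`
of pairwise edge-disjoint `s`–`t` paths and an `s`–`t` cut `C` such that `C` is a
transversal of `Ps`. -/
theorem stmt19 {V E : Type*} (D : MultiDigraph V E) (s t : V) (hst : s ≠ t) :
    ∃ (Ps : Set (List E)) (C : Set E),
      (∀ p ∈ Ps, D.IsPathIn Set.univ s t p) ∧
      Ps.Pairwise (fun p q => p.Disjoint q) ∧
      MultiDigraph.IsTransversal Ps C ∧
      D.IsCut Set.univ s t C := by
  let r : E → E → Prop := fun e f => e = f ∨ D.head e = D.tail f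
  have hr : ∀ e, r e e := fun e => Or.inl rfl
  let L : Set E := {e | D.head e ≠ t}
  let R : Set E := {e | D.tail e ≠ s}
  obtain ⟨hXL, g₀, hg₀⟩ := isWave_maxWave (L := L) (R := R) hr
  obtain ⟨g, hg, -, hgid⟩ := hg₀.exists_eq_id
  obtain ⟨f₀, hf₀⟩ := linked_univ_of_not_hind hr (not_hind_beyond_maxWave (L := L) (R := R) hr)
  obtain ⟨f, hf, -, hfid⟩ := hf₀.exists_eq_id
  generalize hXdef : maxWave r L R = X at *
  rw [Set.inter_univ] at hf hfid
  rw [Set.inter_univ] at hf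
  let C : Set E := {e | e ∉ X ∧ (e ∈ R → e ∈ nb r R X)}
  have hCX : ∀ c ∈ C, c ∉ X := fun c hc => hc.1
  have hCR : ∀ c ∈ C, c ∉ R \ nb r R X := fun c hc h => h.2 (hc.2 h.1)
  have hRX : ∀ e ∈ R \ nb r R X, e ∉ X := fun e he h => he.2 (subset_nb hr h he.1)
  have hcut : ∀ M, D.IsCut M s t C := by
    refine fun M => MultiDigraph.isCut_of_closed (X := X) ?_ ?_ fun e he => hXL he
    · intro e he
      by_cases h : e ∈ X
      · exact Or.inl h
      · exact Or.inr ⟨h, fun h' => absurd he h'⟩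
    · intro e he e' hee'
      by_cases h : e' ∈ X
      · exact Or.inl h
      · exact Or.inr ⟨h, fun h' => ⟨h', e, he, Or.inr hee'⟩⟩
  let P : E → Set E := fun c => {e | (∃ n, e = g^[n] c) ∨ ∃ n, e = f^[n] c}
  have hPg : ∀ c n, g^[n] c ∈ P c := fun c n => Or.inl ⟨n, rfl⟩
  have hPf : ∀ c n, f^[n] c ∈ P c := fun c n => Or.inr ⟨n, rfl⟩
  have hdisj : ∀ c ∈ C, ∀ d ∈ C, ∀ e ∈ P c, e ∈ P d → c = d := by
    have hgf : ∀ c ∈ C, ∀ d ∈ C, ∀ n m, g^[n] c = f^[m] d → c = d := by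
      intro c hc d hd n m h
      rcases iterate_eq_or_mem (c := c) hg hgid n with h1 | h1 <;>
        rcases iterate_eq_or_mem (c := d) hf hfid m with h2 | h2
      · exact h1.symm.trans (h.trans h2)
      · rw [← h, h1] at h2
        exact absurd h2 (hCR c hc)
      · rw [h, h2] at h1
        exact absurd h1 (hCX d hd)
      · exact absurd (h ▸ h1) (hRX _ h2)
    rintro c hc d hd e (⟨n, rfl⟩ | ⟨n, rfl⟩) (⟨m, h⟩ | ⟨m, h⟩)
    · exact eq_of_iterate_eq_iterate hg hgid (hCX c hc) (hCX d hd) h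
    · exact hgf c hc d hd n m h
    · exact (hgf d hd c hc m n h.symm).symm
    · exact eq_of_iterate_eq_iterate hf hfid (hCR c hc) (hCR d hd) h
  have hpath : ∀ c ∈ C, ∃ p, D.IsPathIn (P c) s t p := by
    intro c hc
    obtain ⟨n, hn⟩ := exists_iterate_notMem hg (hCX c hc)
    obtain ⟨m, hm⟩ := exists_iterate_notMem hf (hCR c hc)
    have hs : D.tail (g^[n] c) = s := by
      by_contra h
      refine hn ?_
      rcases iterate_eq_or_mem (c := c) hg hgid n with h1 | h1
      · rw [h1] at h ⊢
        exact hc.2 h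
      · exact subset_nb hr h1 h
    have ht : D.head (f^[m] c) = t := by
      by_contra h
      refine hm ⟨h, ?_⟩
      rcases iterate_eq_or_mem (c := c) hf hfid m with h1 | h1
      · rw [h1]
        exact hc.1
      · exact hRX _ h1
    have hback := reflTransGen_iterate (q := fun a b => D.head b = D.tail a) (hPg c) (fun w => by
      by_cases hw : w ∈ nb r R X
      · exact (hg.1 w hw).2
      · exact Or.inl (hgid w hw)) n
    have hforth := reflTransGen_iterate (q := fun a b => D.head a = D.tail b) (hPf c) (fun w => by
      by_cases hw : w ∈ L \ X
      · exact (hf.1 w hw).2.imp_left Eq.symm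
      · exact Or.inl (hfid w hw)) m
    rw [← hs, ← ht]
    refine MultiDigraph.exists_isPathIn_of_reflTransGen (hPf c m) (.trans ?_ hforth) ?_
    · exact Relation.ReflTransGen.mono (fun a b h => ⟨h.2.1, h.1, h.2.2⟩) _ _
        (Relation.reflTransGen_swap.2 hback)
    · rwa [hs, ht]
  choose! p hp using hpath
  have hpP : ∀ c ∈ C, ∀ e ∈ p c, e ∈ P c := fun c hc => (hp c hc).2.2.2.2.2
  have hpC : ∀ c ∈ C, ∀ e ∈ p c, e ∈ C → e = c := fun c hc e he heC =>
    hdisj e heC c hc e (hPg e 0) (hpP c hc e he)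
  have hcp : ∀ c ∈ C, c ∈ p c := by
    intro c hc
    obtain ⟨e, he, heC⟩ := hcut _ _ (hp c hc)
    exact hpC c hc e he heC ▸ he
  refine ⟨p '' C, C, ?_, ?_, ⟨?_, fun c hc => ⟨p c, ⟨c, hc, rfl⟩, hcp c hc⟩⟩, hcut _⟩
  · rintro _ ⟨c, hc, rfl⟩
    exact (hp c hc).mono (Set.subset_univ _)
  · rintro _ ⟨c, hc, rfl⟩ _ ⟨d, hd, rfl⟩ hne e hec hed
    exact hne (congrArg p (hdisj c hc d hd e (hpP c hc e hec) (hpP d hd e hed)))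
  · rintro _ ⟨c, hc, rfl⟩
    exact ⟨c, ⟨hc, hcp c hc⟩, fun e he => hpC c hc e he.2 he.1⟩
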